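/- The set of pairs (f_0, f_1) realized by 4-polytopes of excess degree strictly larger than 2 is exactly {(f0, f1) : 2·f0 + 1 < f1 ≤ f0·(f0−1)/2}. -/

import Mathlib

open Set

/-- A polytope: the convex hull of a finite set of points. -/
def IsPolytope {n : ℕ} (P : Set (Fin n → ℝ)) : Prop :=
  ∃ S : Finset (Fin n → ℝ), P = convexHull ℝ (S : Set (Fin n → ℝ))

/-- The affine dimension of a set: the rank of its vector span. -/
noncomputable def adim {n : ℕ} (P : Set (Fin n → ℝ)) : ℕ :=
  Module.finrank ℝ (vectorSpan ℝ P)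

/-- A `d`-polytope: a polytope whose affine hull has dimension `d`. -/
def IsDPolytope (d : ℕ) {n : ℕ} (P : Set (Fin n → ℝ)) : Prop :=
  IsPolytope P ∧ adim P = d

/-- An edge of `P`: a face (an extreme convex subset) of affine dimension 1. -/
def IsEdge {n : ℕ} (P E : Set (Fin n → ℝ)) : Prop :=
  IsExtreme ℝ P E ∧ Convex ℝ E ∧ adim E = 1

/-- `f₀ P`: the number of vertices (extreme points) of `P`. -/
noncomputable def f₀ {n : ℕ} (P : Set (Fin n → ℝ)) : ℕ :=
  (Set.extremePoints ℝ P).ncard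

/-- `f₁ P`: the number of edges of `P`. -/
noncomputable def f₁ {n : ℕ} (P : Set (Fin n → ℝ)) : ℕ :=
  {E : Set (Fin n → ℝ) | IsEdge P E}.ncard

/-- `E^d`: the set of `(f₀, f₁)` pairs realized by `d`-polytopes. -/
def fPairs (d : ℕ) : Set (ℕ × ℕ) :=
  {p | ∃ (n : ℕ) (P : Set (Fin n → ℝ)), IsDPolytope d P ∧ f₀ P = p.1 ∧ f₁ P = p.2}

section ExtremeSubsets

variable {E : Type*} [AddCommGroup E] [Module ℝ E]

/-- An extreme convex subset of the convex hull of `V` is the hull of the points of `V` in it. -/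
lemma IsExtreme.eq_convexHull_inter {V F : Set E} (hF : IsExtreme ℝ (convexHull ℝ V) F)
    (hc : Convex ℝ F) : F = convexHull ℝ (F ∩ V) := by
  refine Subset.antisymm (fun x hx => ?_) (convexHull_min inter_subset_left hc)
  have hB : convexHull ℝ (V \ F) ⊆ convexHull ℝ V \ F :=
    convexHull_min (fun y hy => ⟨subset_convexHull ℝ V hy.1, hy.2⟩)
      (hF.convex_sdiff (convex_convexHull ℝ V))
  have hV : V = (F ∩ V) ∪ (V \ F) := by ext y; simp only [mem_union, mem_inter_iff, mem_sdiff]; tauto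
  rcases (V \ F).eq_empty_or_nonempty with h0 | h0
  · rw [h0, union_empty] at hV
    rw [← hV]
    exact hF.subset hx
  rcases (F ∩ V).eq_empty_or_nonempty with h1 | h1
  · rw [h1, empty_union] at hV
    rw [← hV] at hB
    exact absurd hx (hB (hF.subset hx)).2
  have hx' := hF.subset hx
  rw [hV, convexHull_union h1 h0, mem_convexJoin] at hx'
  obtain ⟨a, ha, b, hb, hab⟩ := hx'
  by_cases hxa : x = a
  · rwa [hxa]
  by_cases hxb : x = b
  · exact absurd (hxb ▸ hx) (hB hb).2
  have ho : x ∈ openSegment ℝ a b := mem_openSegment_of_ne_left_right (Ne.symm hxa) (Ne.symm hxb) hab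
  exact absurd (hF.right_mem_of_mem_openSegment
    (convexHull_mono inter_subset_right ha) (hB hb).1 hx ho) (hB hb).2

lemma left_mem_extremePoints_segment (a b : E) : a ∈ extremePoints ℝ (segment ℝ a b) := by
  refine ⟨left_mem_segment ℝ a b, ?_⟩
  intro x hx y hy hxy
  by_cases hab : b = a
  · subst hab
    simpa using hx
  rw [segment_eq_image'] at hx hy
  obtain ⟨s, hs, rfl⟩ := hx
  obtain ⟨t, ht, rfl⟩ := hy
  obtain ⟨α, β, hα, hβ, h1, h⟩ := hxy
  have h2 : (α * s + β * t) • (b - a) = 0 := by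
    calc (α * s + β * t) • (b - a)
        = (α • (a + s • (b - a)) + β • (a + t • (b - a))) - (α + β) • a := by module
      _ = 0 := by rw [h, h1, one_smul, sub_self]
  rcases smul_eq_zero.1 h2 with h3 | h3
  · have : s = 0 := by nlinarith [hs.1, ht.1, mul_nonneg hα.le hs.1, mul_nonneg hβ.le ht.1]
    simp [this]
  · exact absurd (sub_eq_zero.1 h3) hab

end ExtremeSubsets

section PolytopeEdges

variable {n : ℕ}

lemma IsPolytope.finite_extremePoints {P : Set (Fin n → ℝ)} (hP : IsPolytope P) :
    (extremePoints ℝ P).Finite := by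
  obtain ⟨S, rfl⟩ := hP
  exact S.finite_toSet.subset extremePoints_convexHull_subset

lemma IsPolytope.convexHull_extremePoints {P : Set (Fin n → ℝ)} (hP : IsPolytope P) :
    convexHull ℝ (extremePoints ℝ P) = P := by
  have hf := hP.finite_extremePoints
  obtain ⟨S, rfl⟩ := hP
  have h := closure_convexHull_extremePoints (S.finite_toSet.isCompact_convexHull ℝ)
    (convex_convexHull ℝ (S : Set (Fin n → ℝ)))
  rwa [(hf.isClosed_convexHull ℝ).closure_eq] at h

lemma adim_segment {a b : Fin n → ℝ} (hab : a ≠ b) : adim (segment ℝ a b) = 1 := by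
  rw [adim, ← convexHull_pair, ← direction_affineSpan, affineSpan_convexHull,
    direction_affineSpan, vectorSpan_pair]
  exact finrank_span_singleton (sub_ne_zero.2 hab)

/-- Every edge of a polytope contains exactly two vertices. -/
lemma IsEdge.exists_pair {P F : Set (Fin n → ℝ)} (hP : IsPolytope P) (hF : IsEdge P F) :
    ∃ a b, a ≠ b ∧ F ∩ extremePoints ℝ P = {a, b} := by
  obtain ⟨he, hc, hd⟩ := hF
  rw [← hP.convexHull_extremePoints] at he
  have hA := he.eq_convexHull_inter hc
  set A := F ∩ extremePoints ℝ P with hAdef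
  rw [adim, hA, ← direction_affineSpan, affineSpan_convexHull, direction_affineSpan] at hd
  have hcol : Collinear ℝ A := collinear_iff_finrank_le_one.2 hd.le
  have hnt : A.Nontrivial := by
    by_contra h
    rw [not_nontrivial_iff] at h
    rw [(vectorSpan_eq_bot_iff_subsingleton ℝ).2 h] at hd
    simp at hd
  obtain ⟨a, ha, b, hb, hab⟩ := hnt
  have key : ∀ x ∈ A, ∀ y ∈ A, ∀ z ∈ A, Wbtw ℝ x y z → y = x ∨ y = z := by
    intro x hx y hy z hz h
    by_contra! hne
    have ho : y ∈ openSegment ℝ x z :=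
      mem_openSegment_of_ne_left_right hne.1.symm hne.2.symm (mem_segment_iff_wbtw.2 h)
    exact hne.1 (hy.2.2 hx.2.1 hz.2.1 ho).symm
  refine ⟨a, b, hab, Subset.antisymm (fun c hcA => ?_) (insert_subset ha (singleton_subset_iff.2 hb))⟩
  have h3 : Collinear ℝ ({a, b, c} : Set (Fin n → ℝ)) := hcol.subset (by
    rintro x (rfl | rfl | rfl) <;> assumption)
  simp only [mem_insert_iff, mem_singleton_iff]
  rcases h3.wbtw_or_wbtw_or_wbtw with h | h | h
  · have := key _ ha _ hb _ hcA h
    grind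
  · have := key _ hb _ hcA _ ha h
    grind
  · have := key _ hcA _ ha _ hb h
    grind

lemma IsEdge.eq_convexHull {P F : Set (Fin n → ℝ)} (hP : IsPolytope P) (hF : IsEdge P F) :
    F = convexHull ℝ (F ∩ extremePoints ℝ P) := by
  have he := hF.1
  rw [← hP.convexHull_extremePoints] at he
  exact he.eq_convexHull_inter hF.2.1

lemma IsPolytope.f₁_le_choose {P : Set (Fin n → ℝ)} (hP : IsPolytope P) :
    f₁ P ≤ (f₀ P).choose 2 := by
  classical
  have hf := hP.finite_extremePoints
  rw [f₀, ncard_eq_toFinset_card _ hf, ← Finset.card_powersetCard, ← ncard_coe_finset]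
  have hinj : InjOn (fun F => F ∩ extremePoints ℝ P) {F | IsEdge P F} := by
    intro F hF F' hF' h
    rw [IsEdge.eq_convexHull hP hF, IsEdge.eq_convexHull hP hF']
    exact congrArg _ h
  rw [f₁, ← hinj.ncard_image,
    ← ncard_image_of_injective (Finset.powersetCard 2 hf.toFinset : Set (Finset (Fin n → ℝ)))
      Finset.coe_injective]
  refine ncard_le_ncard ?_ ((Finset.finite_toSet _).image _)
  rintro _ ⟨F, hF, rfl⟩
  obtain ⟨a, b, hab, h⟩ := IsEdge.exists_pair hP hF
  refine ⟨{a, b}, ?_, by simp [h]⟩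
  rw [Finset.mem_coe, Finset.mem_powersetCard]
  refine ⟨?_, Finset.card_pair hab⟩
  have : ({a, b} : Set (Fin n → ℝ)) ⊆ extremePoints ℝ P := h ▸ inter_subset_right
  rw [← Finset.coe_subset]
  simpa using this

end PolytopeEdges

section VertexGraph

variable {E : Type*} [AddCommGroup E] [Module ℝ E]

/-- Some linear functional attains its minimum over `V ∪ {a, b}` exactly at `a` and `b`. -/
def Exposed (V : Finset E) (a b : E) : Prop :=
  ∃ φ : E →ₗ[ℝ] ℝ, φ b = φ a ∧ ∀ c ∈ V, c ≠ a → c ≠ b → φ a < φ c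

/-- The graph formed by the pairs of points of `V` which are exposed by a linear functional. -/
def exposedGraph (V : Finset E) : SimpleGraph E where
  Adj a b := a ≠ b ∧ a ∈ V ∧ b ∈ V ∧ Exposed V a b
  symm := ⟨by
    rintro a b ⟨hab, ha, hb, φ, h, h'⟩
    exact ⟨hab.symm, hb, ha, φ, h.symm, fun c hc h1 h2 => h ▸ h' c hc h2 h1⟩⟩
  loopless := ⟨fun _ h => h.1 rfl⟩

lemma finite_edgeSet_exposedGraph (V : Finset E) : (exposedGraph V).edgeSet.Finite := by
  classical
  refine V.sym2.finite_toSet.subset fun z => ?_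
  induction z with
  | h a b => exact fun h => Finset.mk_mem_sym2_iff.2 ⟨h.2.1, h.2.2.1⟩

lemma isExtreme_segment_of_exposed {V : Finset E} {a b : E} (ha : a ∈ V) (hb : b ∈ V)
    (h : Exposed V a b) : IsExtreme ℝ (convexHull ℝ (V : Set E)) (segment ℝ a b) := by
  obtain ⟨φ, hφ, hpos⟩ := h
  set P := convexHull ℝ (V : Set E)
  have hle : ∀ x ∈ P, φ a ≤ φ x := by
    refine fun x hx => convexHull_min (t := {x | φ a ≤ φ x}) (fun c hc => ?_)
      (convex_halfSpace_ge φ.isLinear _) hx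
    by_cases h1 : c = a
    · exact (congrArg φ h1).ge
    by_cases h2 : c = b
    · exact ((congrArg φ h2).trans hφ).ge
    exact (hpos c hc h1 h2).le
  have hext : IsExtreme ℝ P {x | x ∈ P ∧ φ x = φ a} := by
    refine ⟨fun x hx => hx.1, fun x hx y hy z hz hxy => ⟨hx, ?_⟩⟩
    obtain ⟨s, t, hs, ht, hst, rfl⟩ := hxy
    have h1 := hz.2
    simp only [map_add, map_smul, smul_eq_mul] at h1
    have h2 := hle x hx
    have h3 := hle y hy
    have h4 : s * (φ x - φ a) + t * (φ y - φ a) = 0 := by linear_combination h1 - φ a * hst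
    nlinarith [mul_nonneg hs.le (sub_nonneg.2 h2), mul_nonneg ht.le (sub_nonneg.2 h3)]
  have hconv : Convex ℝ {x | x ∈ P ∧ φ x = φ a} :=
    (convex_convexHull ℝ _).inter (convex_hyperplane φ.isLinear _)
  have heq := hext.eq_convexHull_inter hconv
  have hpair : {x | x ∈ P ∧ φ x = φ a} ∩ (V : Set E) = {a, b} := by
    ext x
    simp only [mem_inter_iff, mem_ofPred_eq, mem_insert_iff, mem_singleton_iff, Finset.mem_coe]
    constructor
    · rintro ⟨⟨-, hx⟩, hxV⟩
      by_contra! hne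
      exact (hpos x hxV hne.1 hne.2).ne' hx
    · rintro (rfl | rfl)
      · exact ⟨⟨subset_convexHull ℝ _ ha, rfl⟩, ha⟩
      · exact ⟨⟨subset_convexHull ℝ _ hb, hφ⟩, hb⟩
  rw [hpair, convexHull_pair] at heq
  rwa [heq] at hext

lemma extremePoints_convexHull_eq {V : Finset E} (hV : ∀ a ∈ V, ∃ b, (exposedGraph V).Adj a b) :
    extremePoints ℝ (convexHull ℝ (V : Set E)) = V := by
  refine Subset.antisymm extremePoints_convexHull_subset fun a ha => ?_
  obtain ⟨b, -, -, hb, h⟩ := hV a ha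
  exact (isExtreme_segment_of_exposed ha hb h).extremePoints_subset_extremePoints
    (left_mem_extremePoints_segment a b)

end VertexGraph

section VertexGraphPolytope

variable {n : ℕ}

lemma isEdge_segment {V : Finset (Fin n → ℝ)} {a b : Fin n → ℝ}
    (h : (exposedGraph V).Adj a b) : IsEdge (convexHull ℝ (V : Set (Fin n → ℝ))) (segment ℝ a b) :=
  ⟨isExtreme_segment_of_exposed h.2.1 h.2.2.1 h.2.2.2, convex_segment a b, adim_segment h.1⟩

lemma exposed_of_isExtreme {V : Finset (Fin n → ℝ)} {a b : Fin n → ℝ} {F : Set (Fin n → ℝ)}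
    (hF : IsExtreme ℝ (convexHull ℝ (V : Set (Fin n → ℝ))) F) (hc : Convex ℝ F)
    (h : F ∩ V = {a, b}) : Exposed V a b := by
  have ha : a ∈ F := (h.ge (by simp) : a ∈ F ∩ V).1
  have hb : b ∈ F := (h.ge (by simp) : b ∈ F ∩ V).1
  have hFs : F = segment ℝ a b := by
    rw [hF.eq_convexHull_inter hc, h, convexHull_pair]
  set W : Set (Fin n → ℝ) := (V : Set (Fin n → ℝ)) \ F
  have hW : W.Finite := V.finite_toSet.subset sdiff_subset
  have hB : convexHull ℝ W ⊆ convexHull ℝ (V : Set (Fin n → ℝ)) \ F :=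
    convexHull_min (fun y hy => ⟨subset_convexHull ℝ _ hy.1, hy.2⟩)
      (hF.convex_sdiff (convex_convexHull ℝ _))
  let ℓ : Set (Fin n → ℝ) := line[ℝ, a, b]
  have hdisj : Disjoint (convexHull ℝ W) ℓ := by
    rw [Set.disjoint_left]
    intro z hz hzl
    obtain ⟨r, rfl⟩ := mem_affineSpan_pair_iff_exists_lineMap_eq.1 hzl
    obtain ⟨hzP, hzF⟩ := hB hz
    set z := AffineMap.lineMap a b r with hzdef
    have hz' : z = a + r • (b - a) := by
      rw [hzdef, AffineMap.lineMap_apply, vsub_eq_sub, vadd_eq_add, add_comm]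
    rcases lt_or_ge r 0 with hr | hr
    · refine hzF (hF.right_mem_of_mem_openSegment (hF.subset hb) hzP ha
        ⟨-r / (1 - r), 1 / (1 - r), div_pos (by linarith) (by linarith),
          div_pos one_pos (by linarith), ?_, ?_⟩)
      · rw [← add_div, div_eq_one_iff_eq (by linarith)]; ring
      · have : (1 - r) ≠ 0 := by linarith
        ext i
        simp only [hz', Pi.add_apply, Pi.smul_apply, smul_eq_mul, Pi.sub_apply]
        field_simp
        ring
    rcases le_or_gt r 1 with hr1 | hr1
    · refine hzF (hFs ▸ ?_)
      rw [segment_eq_image']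
      exact ⟨r, ⟨hr, hr1⟩, hz'.symm⟩
    · refine hzF (hF.right_mem_of_mem_openSegment (hF.subset ha) hzP hb
        ⟨(r - 1) / r, 1 / r, div_pos (by linarith) (by linarith),
          div_pos one_pos (by linarith), ?_, ?_⟩)
      · rw [← add_div, div_eq_one_iff_eq (by linarith)]; ring
      · have : r ≠ 0 := by linarith
        ext i
        simp only [hz', Pi.add_apply, Pi.smul_apply, smul_eq_mul, Pi.sub_apply]
        field_simp
        ring
  obtain ⟨f, u, v, hu, huv, hv⟩ := geometric_hahn_banach_compact_closed (convex_convexHull ℝ W)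
    (hW.isCompact_convexHull ℝ) (AffineSubspace.convex _)
    (AffineSubspace.closed_of_finiteDimensional (line[ℝ, a, b])) hdisj
  have hline : ∀ r : ℝ, v < f a + r * (f b - f a) := by
    intro r
    have := hv (AffineMap.lineMap a b r) (AffineMap.lineMap_mem_affineSpan_pair r a b)
    rw [AffineMap.lineMap_apply, vsub_eq_sub, vadd_eq_add, map_add, map_smul, map_sub,
      smul_eq_mul] at this
    linarith
  have hfab : f b = f a := by
    by_contra hne
    have := hline ((v - f a) / (f b - f a))
    rw [div_mul_cancel₀ _ (sub_ne_zero.2 hne)] at this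
    linarith
  refine ⟨-(f : (Fin n → ℝ) →ₗ[ℝ] ℝ), by simp [hfab], fun c hcV hca hcb => ?_⟩
  have hcW : c ∈ W := ⟨hcV, fun hcF => by
    have : c ∈ ({a, b} : Set _) := h ▸ ⟨hcF, hcV⟩
    rcases this with h1 | h1
    exacts [hca h1, hcb h1]⟩
  have h1 := hu c (subset_convexHull ℝ _ hcW)
  have h2 := hline 0
  simp only [LinearMap.neg_apply, ContinuousLinearMap.coe_coe]
  linarith

lemma f₀_convexHull {V : Finset (Fin n → ℝ)} (hV : ∀ a ∈ V, ∃ b, (exposedGraph V).Adj a b) :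
    f₀ (convexHull ℝ (V : Set (Fin n → ℝ))) = V.card := by
  rw [f₀, extremePoints_convexHull_eq hV, ncard_coe_finset]

lemma f₁_convexHull {V : Finset (Fin n → ℝ)} (hV : ∀ a ∈ V, ∃ b, (exposedGraph V).Adj a b) :
    f₁ (convexHull ℝ (V : Set (Fin n → ℝ))) = (exposedGraph V).edgeSet.ncard := by
  have hext := extremePoints_convexHull_eq hV
  have hinter : ∀ a b, (exposedGraph V).Adj a b → segment ℝ a b ∩ (V : Set (Fin n → ℝ)) = {a, b} := by
    intro a b h
    have hP : IsPolytope (convexHull ℝ (V : Set (Fin n → ℝ))) := ⟨V, rfl⟩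
    obtain ⟨c, d, hcd, h2⟩ := (isEdge_segment h).exists_pair hP
    rw [hext] at h2
    have ha : a ∈ ({c, d} : Set (Fin n → ℝ)) := h2 ▸ ⟨left_mem_segment ℝ a b, h.2.1⟩
    have hb : b ∈ ({c, d} : Set (Fin n → ℝ)) := h2 ▸ ⟨right_mem_segment ℝ a b, h.2.2.1⟩
    have hab := h.1
    rw [h2]
    simp only [mem_insert_iff, mem_singleton_iff] at ha hb
    ext x
    simp only [mem_insert_iff, mem_singleton_iff]
    grind
  let g : Sym2 (Fin n → ℝ) → Set (Fin n → ℝ) := fun z => convexHull ℝ {x | x ∈ z}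
  have hg : ∀ a b, g s(a, b) = segment ℝ a b := by
    intro a b
    rw [← convexHull_pair]
    refine congrArg (convexHull ℝ) ?_
    ext x
    simp
  have himg : {F | IsEdge (convexHull ℝ (V : Set (Fin n → ℝ))) F} =
      g '' (exposedGraph V).edgeSet := by
    ext F
    constructor
    · intro hF
      have hP : IsPolytope (convexHull ℝ (V : Set (Fin n → ℝ))) := ⟨V, rfl⟩
      obtain ⟨a, b, hab, h⟩ := hF.exists_pair hP
      have hFs := hF.eq_convexHull hP
      rw [h, convexHull_pair] at hFs
      rw [hext] at h
      have ha : a ∈ F ∩ V := h.ge (by simp)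
      have hb : b ∈ F ∩ V := h.ge (by simp)
      refine ⟨s(a, b), ⟨hab, ha.2, hb.2, exposed_of_isExtreme hF.1 hF.2.1 h⟩, ?_⟩
      rw [hg, ← hFs]
    · rintro ⟨z, hz, rfl⟩
      induction z with
      | h a b => rw [hg]; exact isEdge_segment hz
  rw [f₁, himg, InjOn.ncard_image]
  intro z hz w hw h
  induction z with
  | h a b =>
    induction w with
    | h c d =>
      rw [hg, hg] at h
      have h1 := hinter a b hz
      rw [h, hinter c d hw] at h1
      have h2 : ∀ x, x ∈ s(a, b) ↔ x ∈ s(c, d) := fun x => by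
        have := congrArg (x ∈ ·) h1
        simpa using this.symm
      exact Sym2.ext h2

lemma isDPolytope_convexHull {V : Finset (Fin n → ℝ)}
    (hV : vectorSpan ℝ (V : Set (Fin n → ℝ)) = ⊤) :
    IsDPolytope n (convexHull ℝ (V : Set (Fin n → ℝ))) := by
  refine ⟨⟨V, rfl⟩, ?_⟩
  rw [adim, ← direction_affineSpan, affineSpan_convexHull, direction_affineSpan, hV, finrank_top,
    Module.finrank_fin_fun]

end VertexGraphPolytope

section Stacking

variable {E : Type*} [AddCommGroup E] [Module ℝ E]

open Module Filter Topology

lemma Exposed.mono {V W : Finset E} {a b : E} (h : Exposed W a b) (hVW : V ⊆ W) :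
    Exposed V a b := by
  obtain ⟨φ, h1, h2⟩ := h
  exact ⟨φ, h1, fun c hc => h2 c (hVW hc)⟩

/-- A family biorthogonal to a family of functionals is a basis, if the size is right. -/
lemma exists_basis_of_dual (B : Basis (Fin 4) ℝ E) (b : Fin 4 → E) (c : Fin 4 → E →ₗ[ℝ] ℝ)
    (h : ∀ i j, c i (b j) = if i = j then 1 else 0) :
    ∃ B' : Basis (Fin 4) ℝ E, (∀ i, B' i = b i) ∧ ∀ i x, B'.coord i x = c i x := by
  have hli : LinearIndependent ℝ b := by
    rw [Fintype.linearIndependent_iff]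
    intro g hg i
    have := congrArg (c i) hg
    simpa [h] using this
  let B' := basisOfLinearIndependentOfCardEqFinrank hli (finrank_eq_card_basis B).symm
  have hB' : ∀ i, B' i = b i := fun i => by
    simp [B', coe_basisOfLinearIndependentOfCardEqFinrank]
  refine ⟨B', hB', fun i x => ?_⟩
  have : B'.coord i = c i := B'.ext fun j => by
    rw [hB' j, h, ← hB' j, Basis.coord_apply, Basis.repr_self, Finsupp.single_apply]
    simp only [eq_comm]
  rw [this]

lemma Module.Basis.coord_self_eq_ite (b : Basis (Fin 4) ℝ E) (i j : Fin 4) :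
    b.coord i (b j) = if i = j then 1 else 0 := by
  rw [Basis.coord_apply, Basis.repr_self, Finsupp.single_apply]
  simp only [eq_comm]

/-- The points of `V` affinely span the space, each of them lies in an exposed pair (hence is
extreme), and there are `m` points and `e` exposed pairs. -/
structure Realizes (V : Finset E) (m e : ℕ) : Prop where
  card_eq : V.card = m
  ncard_edgeSet : (exposedGraph V).edgeSet.ncard = e
  exists_adj : ∀ a ∈ V, ∃ b, (exposedGraph V).Adj a b
  vectorSpan_eq : vectorSpan ℝ (V : Set E) = ⊤

/-- Some four affinely independent points of `V` are exactly the points of `V` on a supporting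
hyperplane; `x₀` is a point off that hyperplane. -/
def HasSimplexFacet (V : Finset E) : Prop :=
  ∃ (x₀ : E) (b : Basis (Fin 4) ℝ E) (s : ℝ), s ≠ 0 ∧ (∀ i, x₀ + b i ∈ V) ∧
    ∀ u ∈ V, (∃ i, u = x₀ + b i) ∨ s * (∑ i, b.coord i (u - x₀) - 1) < 0

/-- Adding a point slightly beyond a simplex facet. -/
lemma Realizes.stack [DecidableEq E] {V : Finset E} {m e : ℕ} (hV : Realizes V m e)
    (hF : HasSimplexFacet V) :
    ∃ W : Finset E, Realizes W (m + 1) (e + 4) ∧ HasSimplexFacet W := by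
  obtain ⟨x₀, b, s, hs, hbV, hbeyond⟩ := hF
  set c : Fin 4 → E →ₗ[ℝ] ℝ := fun i => b.coord i with hc
  have hcb : ∀ i j, c i (b j) = if i = j then 1 else 0 := b.coord_self_eq_ite
  have hsum : ∀ x, ∑ i, c i x • b i = x := b.sum_repr
  have hs2 : 0 < s ^ 2 := by positivity
  have hinj : ∀ i j, x₀ + b i = x₀ + b j → i = j := fun i j h => b.injective (add_left_cancel h)
  let t : ℝ → ℝ := fun ε => (1 + s * ε) / 4
  let q : ℝ → E := fun ε => x₀ + t ε • ∑ i, b i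
  have ht0 : t 0 = 1 / 4 := by simp [t]
  have htc : Continuous t := by fun_prop
  have hφq : ∀ (φ : E →ₗ[ℝ] ℝ) ε, φ (q ε) = φ x₀ + t ε * ∑ i, φ (b i) := by
    intro φ ε; simp [q]
  have hcq : ∀ i ε, c i (q ε - x₀) = t ε := by
    intro i ε
    simp [q, hcb]
  have hev : ∀ {f : ℝ → ℝ}, Continuous f → 0 < f 0 → ∀ᶠ ε in 𝓝[>] (0 : ℝ), 0 < f ε := by
    intro f hf h0
    exact (hf.continuousAt.eventually (lt_mem_nhds h0)).filter_mono nhdsWithin_le_nhds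
  have h1 : ∀ᶠ ε in 𝓝[>] (0 : ℝ), ∀ x ∈ V, ∀ y ∈ V, Exposed V x y →
      Exposed (insert (q ε) V) x y := by
    simp only [Finset.eventually_all, eventually_all]
    rintro x hx y hy ⟨φ, hφ, hpos⟩
    have hle : ∀ i, 0 ≤ φ (x₀ + b i) - φ x := by
      intro i
      by_cases h1 : x₀ + b i = x
      · rw [h1, sub_self]
      by_cases h2 : x₀ + b i = y
      · rw [h2, hφ, sub_self]
      exact sub_nonneg.2 (hpos _ (hbV i) h1 h2).le
    have hlt : ∃ i, 0 < φ (x₀ + b i) - φ x := by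
      by_contra! hcon
      have hmem : ∀ i, x₀ + b i = x ∨ x₀ + b i = y := by
        intro i
        by_contra! hne
        exact (hcon i).not_gt (sub_pos.2 (hpos _ (hbV i) hne.1 hne.2))
      have e01 := hinj 0 1
      have e02 := hinj 0 2
      have e12 := hinj 1 2
      have m0 := hmem 0
      have m1 := hmem 1
      have m2 := hmem 2
      have n1 : (0 : Fin 4) ≠ 1 := by decide
      have n2 : (0 : Fin 4) ≠ 2 := by decide
      have n3 : (1 : Fin 4) ≠ 2 := by decide
      grind
    have hpos0 : 0 < φ x₀ + t 0 * ∑ i, φ (b i) - φ x := by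
      have h3 : 0 < ∑ i, (φ (x₀ + b i) - φ x) :=
        Finset.sum_pos' (fun i _ => hle i) (hlt.imp fun i h => ⟨Finset.mem_univ i, h⟩)
      simp only [map_add, Fin.sum_univ_four] at h3 ⊢
      rw [ht0]
      linarith
    filter_upwards [hev (f := fun ε => φ x₀ + t ε * ∑ i, φ (b i) - φ x) (by fun_prop) hpos0]
      with ε hε
    refine ⟨φ, hφ, fun u hu hux huy => ?_⟩
    rcases Finset.mem_insert.1 hu with rfl | hu
    · rw [hφq]; linarith
    · exact hpos u hu hux huy
  have h2 : ∀ᶠ ε in 𝓝[>] (0 : ℝ), ∀ u ∈ V, s * (∑ i, c i (u - x₀) - 1) < 0 → ∀ i,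
      0 < (1 - t ε) * -(s * (∑ i, c i (u - x₀) - 1)) + s ^ 2 * ε * (1 - c i (u - x₀)) ∧
      0 < -(s * (∑ i, c i (u - x₀) - 1)) * t ε + s ^ 2 * ε * c i (u - x₀) := by
    simp only [Finset.eventually_all, eventually_all]
    intro u hu hneg i
    refine (hev (by fun_prop) ?_).and (hev (by fun_prop) ?_) <;> rw [ht0] <;> linarith
  have ht : ∀ᶠ ε in 𝓝[>] (0 : ℝ), 0 < t ε ∧ 0 < 1 - t ε :=
    (hev htc (by rw [ht0]; norm_num)).and (hev (by fun_prop) (by rw [ht0]; norm_num))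
  obtain ⟨ε, hold, hnew, ⟨htpos, htlt⟩, hε⟩ :=
    (h1.and (h2.and (ht.and self_mem_nhdsWithin))).exists
  replace hε : 0 < ε := hε
  clear h1 h2 ht
  have h4t : 4 * t ε = 1 + s * ε := by simp only [t]; ring
  have hqV : q ε ∉ V := by
    intro hq
    rcases hbeyond _ hq with ⟨i, hi⟩ | h
    · have h3 := hcq
      obtain ⟨j, hj⟩ : ∃ j : Fin 4, j ≠ i := exists_ne i
      have := hcq j ε
      rw [hi, add_sub_cancel_left, hcb, if_neg hj] at this
      exact htpos.ne this
    · have h5 : ∑ i, b.coord i (q ε - x₀) = 4 * t ε := by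
        rw [Fin.sum_univ_four]; simp only [hc] at hcq; rw [hcq, hcq, hcq, hcq]; ring
      rw [h5, h4t] at h
      nlinarith [mul_pos hs2 hε]
  have hqb : ∀ i, x₀ + b i ≠ q ε := fun i h => hqV (h ▸ hbV i)
  have hfacet : ∀ i, Exposed (insert (q ε) V) (q ε) (x₀ + b i) := by
    intro i
    let φ : E →ₗ[ℝ] ℝ := -((1 - t ε) * s) • (∑ j, c j) - (s ^ 2 * ε) • c i
    have hφ : ∀ x y, φ x - φ y = -((1 - t ε) * s) * (∑ j, c j (x - y)) - s ^ 2 * ε * c i (x - y) := by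
      intro x y
      rw [← map_sub]
      simp [φ]
    have hφ2 : ∀ x, φ x - φ x₀ = -((1 - t ε) * s) * (∑ j, c j (x - x₀)) - s ^ 2 * ε * c i (x - x₀) :=
      fun x => hφ x x₀
    have hq0 : φ (q ε) - φ x₀ = -((1 - t ε) * s) * (4 * t ε) - s ^ 2 * ε * t ε := by
      rw [hφ2]; simp only [Fin.sum_univ_four, hcq]; ring
    have hb0 : ∀ j, φ (x₀ + b j) - φ x₀ =
        -((1 - t ε) * s) - s ^ 2 * ε * (if i = j then 1 else 0) := by
      intro j
      rw [hφ2, add_sub_cancel_left]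
      simp [hcb]
    rw [h4t] at hq0
    refine ⟨φ, ?_, fun u hu huq hui => ?_⟩
    · have := hb0 i
      rw [if_pos rfl] at this
      linear_combination this - hq0
    · have hu := (Finset.mem_insert.1 hu).resolve_left huq
      rcases hbeyond u hu with ⟨j, rfl⟩ | hneg
      · have hij : i ≠ j := fun h => hui (by rw [h])
        have := hb0 j
        rw [if_neg hij] at this
        have : 0 < (1 - t ε) * (s ^ 2 * ε) := by positivity
        nlinarith
      · have h5 := (hnew u hu hneg i).1
        have h6 := hφ2 u
        nlinarith
  have hnot : ∀ u ∈ V, Exposed (insert (q ε) V) (q ε) u → ∃ i, u = x₀ + b i := by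
    rintro u hu ⟨φ, hφ, hpos⟩
    by_contra hcon
    have hneg := (hbeyond u hu).resolve_left hcon
    push Not at hcon
    have hco := fun i => (hnew u hu hneg i).2
    set D := -(s * (∑ i, c i (u - x₀) - 1)) with hD
    have hlt : ∀ i, 0 < φ (x₀ + b i) - φ (q ε) := fun i =>
      sub_pos.2 (hpos _ (Finset.mem_insert_of_mem (hbV i)) (hqb i) (hcon i).symm)
    have hu' : φ u - φ x₀ = ∑ i, c i (u - x₀) * φ (b i) := by
      rw [← map_sub]
      conv_lhs => rw [← hsum (u - x₀)]
      simp
    have hqq := hφq φ ε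
    have h7 : 0 < ∑ i, (D * t ε + s ^ 2 * ε * c i (u - x₀)) * (φ (x₀ + b i) - φ (q ε)) :=
      Finset.sum_pos (fun i _ => mul_pos (hco i) (hlt i)) Finset.univ_nonempty
    simp only [Fin.sum_univ_four, map_add] at h7 hD hu' hqq
    have : (0 : ℝ) < 0 := by
      refine h7.trans_eq ?_
      linear_combination (-D) * hqq - (s ^ 2 * ε) * hu' + (s ^ 2 * ε) * hφ
        + D * (φ x₀ - φ (q ε)) * h4t + s * ε * (φ x₀ - φ (q ε)) * hD
    exact lt_irrefl _ this
  have hedges : (exposedGraph (insert (q ε) V)).edgeSet =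
      (exposedGraph V).edgeSet ∪ range (fun i : Fin 4 => s(q ε, x₀ + b i)) := by
    have hadj : ∀ u v, (exposedGraph (insert (q ε) V)).Adj u v → u = q ε →
        s(u, v) ∈ range (fun i : Fin 4 => s(q ε, x₀ + b i)) := by
      rintro _ v ⟨hne, -, hv, hex⟩ rfl
      have hv := (Finset.mem_insert.1 hv).resolve_left hne.symm
      obtain ⟨i, rfl⟩ := hnot v hv hex
      exact ⟨i, rfl⟩
    ext z
    induction z with
    | h u v =>
      constructor
      · intro h
        by_cases hu : u = q ε
        · exact Or.inr (hadj u v h hu)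
        by_cases hv : v = q ε
        · rw [Sym2.eq_swap]
          exact Or.inr (hadj v u h.symm hv)
        exact Or.inl ⟨h.1, Finset.mem_of_mem_insert_of_ne h.2.1 hu,
          Finset.mem_of_mem_insert_of_ne h.2.2.1 hv, h.2.2.2.mono (Finset.subset_insert _ _)⟩
      · rintro (h | ⟨i, hi⟩)
        · exact ⟨h.1, Finset.mem_insert_of_mem h.2.1, Finset.mem_insert_of_mem h.2.2.1,
            hold u h.2.1 v h.2.2.1 h.2.2.2⟩
        · rw [← hi]
          exact ⟨(hqb i).symm, Finset.mem_insert_self _ _, Finset.mem_insert_of_mem (hbV i),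
            hfacet i⟩
  refine ⟨insert (q ε) V, ⟨?_, ?_, ?_, ?_⟩, ?_⟩
  · rw [Finset.card_insert_of_notMem hqV, hV.card_eq]
  · rw [hedges, ncard_union_eq ?_ (finite_edgeSet_exposedGraph V) (finite_range _),
      hV.ncard_edgeSet, ← image_univ, ncard_image_of_injective, ncard_univ, Nat.card_fin]
    · intro i j hij
      exact hinj i j (Sym2.congr_right.1 hij)
    · rw [Set.disjoint_right]
      rintro _ ⟨i, rfl⟩ h
      exact hqV h.2.1
  · intro a ha
    rcases Finset.mem_insert.1 ha with rfl | ha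
    · exact ⟨x₀ + b 0, (hqb 0).symm, Finset.mem_insert_self _ _,
        Finset.mem_insert_of_mem (hbV 0), hfacet 0⟩
    · obtain ⟨y, hy⟩ := hV.exists_adj a ha
      exact ⟨y, hy.1, Finset.mem_insert_of_mem ha, Finset.mem_insert_of_mem hy.2.2.1,
        hold a ha y hy.2.2.1 hy.2.2.2⟩
  · rw [eq_top_iff, ← hV.vectorSpan_eq]
    exact vectorSpan_mono ℝ (by simp)
  · let b' : Fin 4 → E := fun i => if i = 0 then t ε • ∑ i, b i else b i
    let c' : Fin 4 → E →ₗ[ℝ] ℝ := fun i => if i = 0 then (t ε)⁻¹ • c 0 else c i - c 0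
    have hdual : ∀ i j, c' i (b' j) = if i = j then 1 else 0 := by
      intro i j
      fin_cases i <;> fin_cases j <;>
        simp [b', c', hcb, Fin.sum_univ_four, htpos.ne']
    obtain ⟨B, hB, hBc⟩ := exists_basis_of_dual b b' c' hdual
    refine ⟨x₀, B, s, hs, fun i => ?_, fun u hu => ?_⟩
    · rw [hB]
      by_cases hi : i = 0
      · simp only [b', if_pos hi]; exact Finset.mem_insert_self _ _
      · simp only [b', if_neg hi]; exact Finset.mem_insert_of_mem (hbV i)
    · have hval : s * (∑ i, B.coord i (u - x₀) - 1) =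
          s * (∑ i, c i (u - x₀) - 1) - s ^ 2 * ε / t ε * c 0 (u - x₀) := by
        simp only [hBc, Fin.sum_univ_four, c', if_pos, LinearMap.smul_apply, LinearMap.sub_apply,
          smul_eq_mul, show (1 : Fin 4) ≠ 0 by decide, show (2 : Fin 4) ≠ 0 by decide,
          show (3 : Fin 4) ≠ 0 by decide, if_false]
        field_simp
        linear_combination (-s * c 0 (u - x₀)) * h4t
      rcases Finset.mem_insert.1 hu with rfl | hu
      · exact Or.inl ⟨0, by rw [hB]; simp [b', q]⟩
      rcases hbeyond u hu with ⟨i, rfl⟩ | hneg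
      · by_cases hi : i = 0
        · right
          rw [hval, add_sub_cancel_left]
          simp only [hcb, hi, Fin.sum_univ_four]
          have : 0 < s ^ 2 * ε / t ε := by positivity
          simpa using this
        · exact Or.inl ⟨i, by rw [hB]; simp [b', hi]⟩
      · right
        have h5 := (hnew u hu hneg 0).2
        rw [hval]
        have h6 : s * (∑ i, c i (u - x₀) - 1) - s ^ 2 * ε / t ε * c 0 (u - x₀) =
          -((-(s * (∑ i, c i (u - x₀) - 1)) * t ε + s ^ 2 * ε * c 0 (u - x₀)) / t ε) := by
          field_simp
          ring
        rw [h6, neg_lt_zero]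
        exact div_pos h5 htpos

end Stacking

section Truncation

variable {E : Type*} [AddCommGroup E] [Module ℝ E]

open Module Filter Topology

/-- A vertex `x₀` of degree four, two of whose neighbours are adjacent to each other and span
a triangular face with `x₀`. -/
def HasSimpleVertex (V : Finset E) : Prop :=
  ∃ x₀ ∈ V, ∃ b : Basis (Fin 4) ℝ E, (∀ i, x₀ + b i ∈ V) ∧
    (∀ u ∈ V, ∀ i, 0 ≤ b.coord i (u - x₀)) ∧
    (∀ u ∈ V, b.coord 2 (u - x₀) = 0 → b.coord 3 (u - x₀) = 0 →
      u = x₀ ∨ u = x₀ + b 0 ∨ u = x₀ + b 1) ∧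
    (∀ i, ∀ u ∈ V, (∀ j ≠ i, b.coord j (u - x₀) = 0) → u = x₀ ∨ u = x₀ + b i) ∧
    Exposed V (x₀ + b 0) (x₀ + b 1)

/-- Cutting off a simple vertex `x₀` by the hyperplane through the points `x₀ + b i`; the first
`r` of these are old vertices. -/
lemma Realizes.truncate_aux [DecidableEq E] {V : Finset E} {m e r : ℕ} (hV : Realizes V m e)
    {x₀ : E} (hx₀ : x₀ ∈ V) (b : Basis (Fin 4) ℝ E) (t : Fin 4 → ℝ) (ht1 : ∀ i, 1 ≤ t i)
    (hw : ∀ i, x₀ + t i • b i ∈ V) (hnn : ∀ u ∈ V, ∀ i, 0 ≤ b.coord i (u - x₀))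
    (hcut : ∀ u ∈ V, u ≠ x₀ → (∀ i, u ≠ x₀ + b i) → 1 < ∑ i, b.coord i (u - x₀))
    (hray : ∀ i, ∀ u ∈ V, (∀ j ≠ i, b.coord j (u - x₀) = 0) → u = x₀ ∨ u = x₀ + t i • b i)
    (hr : r ≤ 2) (htr : ∀ i, t i = 1 ↔ (i : ℕ) < r)
    (hadj : 2 ≤ r → Exposed V (x₀ + b 0) (x₀ + b 1)) :
    ∃ (W : Finset E) (m' e' : ℕ), m' + r = m + 3 ∧ e' + r + r.choose 2 = e + 6 ∧
      Realizes W m' e' ∧ HasSimplexFacet W ∧ HasSimpleVertex W := by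
  set c : Fin 4 → E →ₗ[ℝ] ℝ := fun i => b.coord i with hc
  have hcb : ∀ i j, c i (b j) = if i = j then 1 else 0 := b.coord_self_eq_ite
  have hsum : ∀ x, ∑ i, c i x • b i = x := b.sum_repr
  have hφ : ∀ (φ : E →ₗ[ℝ] ℝ) x, φ x - φ x₀ = ∑ i, c i (x - x₀) * φ (b i) := by
    intro φ x
    rw [← map_sub]
    conv_lhs => rw [← hsum (x - x₀)]
    simp
  have hext : ∀ x y : E, (∀ i, c i (x - x₀) = c i (y - x₀)) → x = y := by
    intro x y h
    have : x - x₀ = y - x₀ := by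
      rw [← hsum (x - x₀), ← hsum (y - x₀)]
      simp only [h]
    exact sub_left_injective this
  let p : Fin 4 → E := fun i => x₀ + b i
  let w : Fin 4 → E := fun i => x₀ + t i • b i
  have hcp : ∀ i j, c i (p j - x₀) = if i = j then 1 else 0 := fun i j => by
    simp only [p, add_sub_cancel_left, hcb]
  have hcw : ∀ i j, c i (w j - x₀) = if i = j then t i else 0 := fun i j => by
    simp only [w, add_sub_cancel_left, map_smul, hcb, smul_eq_mul, mul_ite, mul_one, mul_zero]
    grind
  have hc0 : ∀ i, c i (x₀ - x₀) = 0 := fun i => by simp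
  have hpinj : ∀ i j, p i = p j → i = j := fun i j h => b.injective (add_left_cancel h)
  have hp0 : ∀ i, p i ≠ x₀ := fun i h => by
    have := hcp i i
    rw [h, hc0] at this
    simp at this
  have hw0 : ∀ i, w i ≠ x₀ := fun i h => by
    have := hcw i i
    rw [h, hc0, if_pos rfl] at this
    linarith [ht1 i]
  have hpw : ∀ i j, p i = w j → i = j ∧ t j = 1 := fun i j h => by
    have h1 := hcp j i
    rw [h, hcw, if_pos rfl] at h1
    have := ht1 j
    by_cases hij : j = i
    · rw [if_pos hij] at h1
      exact ⟨hij.symm, h1⟩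
    · rw [if_neg hij] at h1
      linarith
  have hwinj : ∀ i j, w i = w j → i = j := fun i j h => by
    have h1 := hcw i j
    rw [← h, hcw, if_pos rfl] at h1
    by_contra hij
    rw [if_neg hij] at h1
    linarith [ht1 i]
  have hpV : ∀ i, p i ∈ V → t i = 1 := fun i hi => by
    rcases hray i _ hi (fun j hj => (hcp j i).trans (if_neg hj)) with h | h
    · exact absurd h (hp0 i)
    · exact (hpw i i h).2
  have hpw1 : ∀ i, t i = 1 → w i = p i := fun i hi => by simp only [w, p, hi, one_smul]
  have hpV' : ∀ i, t i = 1 → p i ∈ V := fun i hi => hpw1 i hi ▸ hw i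
  have hwp : ∀ i (φ : E →ₗ[ℝ] ℝ), t i * (φ (p i) - φ x₀) = φ (w i) - φ x₀ := fun i φ => by
    simp [p, w]
  -- the neighbours of `x₀`
  have hnbr : ∀ i, Exposed V x₀ (w i) := by
    intro i
    refine ⟨(∑ j, c j) - c i, ?_, fun u hu hu0 hui => ?_⟩
    · have := hφ ((∑ j, c j) - c i) (w i)
      rw [← sub_eq_zero, this]
      simp [hcw, hcb]
    · have h1 := hφ ((∑ j, c j) - c i) u
      have h2 : ∑ k, c k (u - x₀) * ((∑ j, c j) - c i) (b k) =
          ∑ k, if k = i then 0 else c k (u - x₀) := by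
        refine Finset.sum_congr rfl fun k _ => ?_
        simp only [LinearMap.sub_apply, LinearMap.sum_apply, hcb]
        by_cases hki : k = i
        · simp [hki]
        · simp [hki, Ne.symm hki]
      rw [h2] at h1
      have h3 : 0 < ∑ k, if k = i then 0 else c k (u - x₀) := by
        by_contra hcon
        have hnn' : ∀ k ∈ Finset.univ, 0 ≤ if k = i then 0 else c k (u - x₀) := fun k _ => by
          split_ifs
          exacts [le_rfl, hnn u hu k]
        have h4 := le_antisymm (not_lt.1 hcon) (Finset.sum_nonneg hnn')
        rw [Finset.sum_eq_zero_iff_of_nonneg hnn'] at h4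
        rcases hray i u hu (fun j hj => by
          have := h4 j (Finset.mem_univ j)
          rwa [if_neg hj] at this) with h | h
        exacts [hu0 h, hui h]
      linarith
  have hnbr' : ∀ u ∈ V, u ≠ x₀ → Exposed V x₀ u → ∃ i, u = w i := by
    rintro u hu hu0 ⟨φ, hφu, hpos⟩
    by_contra! hcon
    have h1 := hφ φ u
    rw [hφu, sub_self] at h1
    have hb : ∀ i, 0 < φ (b i) := fun i => by
      have h2 := hpos (w i) (hw i) (hw0 i) (hcon i).symm
      have h3 : φ (w i) = φ x₀ + t i * φ (b i) := by simp [w]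
      have := ht1 i
      by_contra h4
      nlinarith
    have hnn' : ∀ k ∈ Finset.univ, 0 ≤ c k (u - x₀) * φ (b k) := fun k _ =>
      mul_nonneg (hnn u hu k) (hb k).le
    have h4 := (Finset.sum_eq_zero_iff_of_nonneg hnn').1 h1.symm
    refine hu0 (hext _ _ fun i => ?_)
    rw [hc0]
    exact (mul_eq_zero.1 (h4 i (Finset.mem_univ i))).resolve_right (hb i).ne'
  let W : Finset E := V.erase x₀ ∪ Finset.univ.image p
  have hpW : ∀ i, p i ∈ W := fun i =>
    Finset.mem_union_right _ (Finset.mem_image_of_mem p (Finset.mem_univ i))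
  have hVW : ∀ u ∈ V, u ≠ x₀ → u ∈ W := fun u hu h =>
    Finset.mem_union_left _ (Finset.mem_erase.2 ⟨h, hu⟩)
  have hWcases : ∀ u ∈ W, (∃ i, u = p i) ∨ (u ∈ V ∧ u ≠ x₀ ∧ ∀ i, u ≠ p i) := by
    intro u hu
    by_cases h : ∃ i, u = p i
    · exact Or.inl h
    · push Not at h
      rcases Finset.mem_union.1 hu with h1 | h1
      · exact Or.inr ⟨Finset.mem_of_mem_erase h1, Finset.ne_of_mem_erase h1, h⟩
      · obtain ⟨i, -, rfl⟩ := Finset.mem_image.1 h1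
        exact absurd rfl (h i)
  have hWnn : ∀ u ∈ W, ∀ i, 0 ≤ c i (u - x₀) := by
    intro u hu i
    rcases hWcases u hu with ⟨j, rfl⟩ | h
    · rw [hcp]; split_ifs <;> simp
    · exact hnn u h.1 i
  -- old exposed pairs remain exposed
  have hold : ∀ u ∈ V, ∀ v ∈ V, u ≠ x₀ → v ≠ x₀ → Exposed V u v → Exposed W u v := by
    rintro u hu v hv hu0 hv0 ⟨φ, hφv, hpos⟩
    refine ⟨φ, hφv, fun y hy hyu hyv => ?_⟩
    rcases hWcases y hy with ⟨i, rfl⟩ | h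
    · by_cases hi : t i = 1
      · exact hpos _ (hpV' i hi) hyu hyv
      · have h0 := hpos x₀ hx₀ hu0.symm hv0.symm
        have h1 : φ u ≤ φ (w i) := by
          by_cases h1 : w i = u
          · rw [h1]
          by_cases h2 : w i = v
          · rw [h2, hφv]
          exact (hpos _ (hw i) h1 h2).le
        have h2 := hwp i φ
        have h3 : 1 < t i := lt_of_le_of_ne (ht1 i) (Ne.symm hi)
        by_contra hcon
        nlinarith
    · exact hpos y h.1 hyu hyv
  -- a functional exposing a pair in `W` is large at `x₀`
  have hlarge : ∀ u ∈ W, ∀ v ∈ W, (∀ i, u ≠ p i) → ∀ φ : E →ₗ[ℝ] ℝ, φ v = φ u →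
      (∀ y ∈ W, y ≠ u → y ≠ v → φ u < φ y) → (∃ i, v = p i ∧ u = w i) ∨ φ u < φ x₀ := by
    intro u hu v hv hup φ hφv hpos
    obtain ⟨huV, hu0, -⟩ := (hWcases u hu).resolve_left (by simpa using hup)
    have hσ := hcut u huV hu0 hup
    have hle : ∀ i, 0 ≤ φ (p i) - φ u := fun i => by
      by_cases h2 : p i = v
      · rw [h2, hφv, sub_self]
      exact sub_nonneg.2 (hpos _ (hpW i) (hup i).symm h2).le
    by_cases hex : ∃ i, 0 < c i (u - x₀) ∧ φ u < φ (p i)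
    · right
      obtain ⟨i, hi1, hi2⟩ := hex
      have h1 := hφ φ u
      have h2 : 0 < ∑ i, c i (u - x₀) * (φ (p i) - φ u) :=
        Finset.sum_pos' (fun i _ => mul_nonneg (hnn u huV i) (hle i))
          ⟨i, Finset.mem_univ i, mul_pos hi1 (sub_pos.2 hi2)⟩
      simp only [p, map_add, Fin.sum_univ_four] at h1 h2 hσ
      simp only [← hc] at hσ
      by_contra hcon
      nlinarith
    · left
      push Not at hex
      have hv' : ∀ i, 0 < c i (u - x₀) → p i = v := fun i hi => by
        by_contra hne
        exact (hex i hi).not_gt (hpos _ (hpW i) (hup i).symm hne)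
      obtain ⟨i, -, hi⟩ : ∃ i ∈ Finset.univ, 0 < c i (u - x₀) :=
        Finset.exists_lt_of_sum_lt (f := fun _ => 0) (by
          rw [Finset.sum_const_zero]; exact one_pos.trans hσ)
      refine ⟨i, (hv' i hi).symm, ?_⟩
      refine (hray i u huV fun j hj => ?_).resolve_left hu0
      by_contra hne
      have := hv' j (lt_of_le_of_ne (hnn u huV j) (Ne.symm hne))
      exact hj (hpinj _ _ (this.trans (hv' i hi).symm))
  have hpp : ∀ i j, i ≠ j → Exposed W (p i) (p j) := by
    intro i j hij
    have hK : ∀ᶠ K : ℝ in atTop, ∀ u ∈ W, 1 < ∑ k, c k (u - x₀) →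
        c i (u - x₀) + c j (u - x₀) - 1 < K * (∑ k, c k (u - x₀) - 1) := by
      simp only [Finset.eventually_all, eventually_all]
      intro u hu hσ
      filter_upwards [eventually_gt_atTop
        ((c i (u - x₀) + c j (u - x₀) - 1) / (∑ k, c k (u - x₀) - 1))] with K hK
      rwa [div_lt_iff₀ (sub_pos.2 hσ)] at hK
    obtain ⟨K, hK⟩ := hK.exists
    let φ : E →ₗ[ℝ] ℝ := K • (∑ k, c k) - (c i + c j)
    have hφ' : ∀ x, φ x - φ x₀ = K * ∑ k, c k (x - x₀) - (c i (x - x₀) + c j (x - x₀)) := by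
      intro x
      rw [← map_sub]
      simp [φ]
    have hφp : ∀ k, φ (p k) - φ x₀ = K - ((if i = k then 1 else 0) + if j = k then 1 else 0) := by
      intro k
      rw [hφ']
      simp [hcp]
    have hi := hφp i
    have hj := hφp j
    simp only [hij, hij.symm, if_true, if_false] at hi hj
    refine ⟨φ, by linarith, fun u hu hui huj => ?_⟩
    rcases hWcases u hu with ⟨k, rfl⟩ | ⟨h1, h2, h3⟩
    · have hk := hφp k
      rw [if_neg (fun h => hui (by rw [h])), if_neg (fun h => huj (by rw [h]))] at hk
      linarith
    · have h4 := hK u hu (hcut u h1 h2 h3)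
      have h5 := hφ' u
      nlinarith
  have hpwe : ∀ i, Exposed W (p i) (w i) := by
    intro i
    obtain ⟨φ, h1, hpos⟩ := hnbr i
    have h2 := hwp i φ
    rw [h1, sub_self, mul_eq_zero] at h2
    have h3 : φ (p i) = φ x₀ := sub_eq_zero.1 (h2.resolve_left (by linarith [ht1 i]))
    refine ⟨φ, h1.trans h3.symm, fun u hu hup huw => ?_⟩
    rw [h3]
    rcases hWcases u hu with ⟨j, rfl⟩ | h
    · have hji : j ≠ i := fun h => hup (by rw [h])
      have h4 := hwp j φ
      have h5 := hpos (w j) (hw j) (hw0 j) (fun h => hji (hwinj _ _ h))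
      have := ht1 j
      by_contra hcon
      nlinarith
    · exact hpos u h.1 h.2.1 huw
  let I : Finset (Fin 4) := Finset.univ.filter fun i => r ≤ i
  let J : Finset (Fin 4 × Fin 4) := Finset.univ.filter fun x => x.1 < x.2 ∧ r ≤ x.2
  have hI : I.card + r = 4 := by
    have h : ∀ r : ℕ, r ≤ 2 → (Finset.univ.filter fun i : Fin 4 => r ≤ i).card + r = 4 := by decide
    exact h r hr
  have hJ : J.card + r.choose 2 = 6 := by
    have h : ∀ r : ℕ, r ≤ 2 → (Finset.univ.filter fun x : Fin 4 × Fin 4 =>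
      x.1 < x.2 ∧ r ≤ x.2).card + r.choose 2 = 6 := by decide
    exact h r hr
  have hIt : ∀ i : Fin 4, r ≤ i ↔ t i ≠ 1 := fun i => by rw [Ne, htr, not_lt]
  have hnotV : ∀ i : Fin 4, r ≤ i → p i ∉ V := fun i hi h => (hIt i).1 hi (hpV i h)
  let A : Finset (Sym2 E) := I.image fun i => s(p i, w i)
  let B : Finset (Sym2 E) := J.image fun x => s(p x.1, p x.2)
  let R : Finset (Sym2 E) := Finset.univ.image fun i => s(x₀, w i)
  have hWadj : ∀ u v, (exposedGraph W).Adj u v → (∀ i, u ≠ p i) →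
      s(u, v) ∈ ((exposedGraph V).edgeSet \ (R : Set (Sym2 E))) ∪ A ∪ B := by
    rintro u v ⟨huv, hu, hv, φ, hφv, hpos⟩ hup
    obtain ⟨huV, hu0, -⟩ := (hWcases u hu).resolve_left (by simpa using hup)
    by_cases hvV : v ∈ V
    · have hv0 : v ≠ x₀ := by
        rcases hWcases v hv with ⟨i, rfl⟩ | h
        exacts [hp0 i, h.2.1]
      rcases hlarge u hu v hv hup φ hφv hpos with ⟨i, rfl, rfl⟩ | h
      · exact absurd (hpw1 i (hpV i hvV)) (hup i)
      · refine Or.inl (Or.inl ⟨⟨huv, huV, hvV, φ, hφv, fun y hy hyu hyv => ?_⟩, ?_⟩)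
        · by_cases hy0 : y = x₀
          · rwa [hy0]
          · exact hpos y (hVW y hy hy0) hyu hyv
        · intro hR
          obtain ⟨i, -, hi⟩ := Finset.mem_image.1 (Finset.mem_coe.1 hR)
          have : x₀ ∈ s(u, v) := hi ▸ Sym2.mem_mk_left _ _
          rcases Sym2.mem_iff.1 this with h | h
          exacts [hu0 h.symm, hv0 h.symm]
    · obtain ⟨i, rfl⟩ := (hWcases v hv).resolve_right (fun h => hvV h.1)
      have hti : t i ≠ 1 := fun h => hvV (hpV' i h)
      have huw : u = w i := by
        rcases hlarge u hu _ hv hup φ hφv hpos with ⟨j, hj, rfl⟩ | h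
        · rw [hpinj _ _ hj]
        · by_contra hne
          have h1 := hpos (w i) (hVW _ (hw i) (hw0 i)) (Ne.symm hne)
            (fun h => hti (hpw i i h.symm).2)
          have h2 := hwp i φ
          have h3 : 1 < t i := lt_of_le_of_ne (ht1 i) (Ne.symm hti)
          rw [hφv] at h2
          nlinarith
      refine Or.inl (Or.inr (Finset.mem_coe.2 (Finset.mem_image.2 ⟨i, ?_, ?_⟩)))
      · exact Finset.mem_filter.2 ⟨Finset.mem_univ _, (hIt i).2 hti⟩
      · rw [huw, Sym2.eq_swap]
  have hpadj : ∀ i j, i < j →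
      s(p i, p j) ∈ ((exposedGraph V).edgeSet \ (R : Set (Sym2 E))) ∪ A ∪ B := by
    intro i j hij
    by_cases hj : r ≤ j
    · exact Or.inr (Finset.mem_coe.2 (Finset.mem_image.2
        ⟨(i, j), Finset.mem_filter.2 ⟨Finset.mem_univ _, hij, hj⟩, rfl⟩))
    · have hij' : (i : ℕ) < j := hij
      obtain rfl : i = 0 := by ext; simp; omega
      obtain rfl : j = 1 := by ext; simp; omega
      have h0 : p 0 ∈ V := hpV' 0 ((htr 0).2 (by simp; omega))
      have h1 : p 1 ∈ V := hpV' 1 ((htr 1).2 (by simp; omega))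
      refine Or.inl (Or.inl ⟨⟨fun h => by simpa using hpinj _ _ h, h0, h1, hadj ?_⟩, ?_⟩)
      · simp at hj; omega
      · intro hR
        obtain ⟨i, -, hi⟩ := Finset.mem_image.1 (Finset.mem_coe.1 hR)
        have : x₀ ∈ s(p 0, p 1) := hi ▸ Sym2.mem_mk_left _ _
        rcases Sym2.mem_iff.1 this with h | h
        exacts [hp0 _ h.symm, hp0 _ h.symm]
  have hedges : (exposedGraph W).edgeSet =
      ((exposedGraph V).edgeSet \ (R : Set (Sym2 E))) ∪ A ∪ B := by
    ext z
    induction z with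
    | h u v =>
      constructor
      · intro h
        by_cases hu : ∀ i, u ≠ p i
        · exact hWadj u v h hu
        by_cases hv : ∀ i, v ≠ p i
        · rw [Sym2.eq_swap]
          exact hWadj v u h.symm hv
        push Not at hu hv
        obtain ⟨i, rfl⟩ := hu
        obtain ⟨j, rfl⟩ := hv
        rcases lt_trichotomy i j with hij | rfl | hij
        · exact hpadj i j hij
        · exact absurd rfl h.1
        · rw [Sym2.eq_swap]
          exact hpadj j i hij
      · rintro ((⟨h, hR⟩ | h) | h)
        · have hnot : ∀ u v, (exposedGraph V).Adj u v → s(u, v) ∉ (R : Set (Sym2 E)) → u ≠ x₀ := by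
            rintro u v h hR rfl
            obtain ⟨i, rfl⟩ := hnbr' v h.2.2.1 h.1.symm h.2.2.2
            exact hR (Finset.mem_coe.2 (Finset.mem_image_of_mem _ (Finset.mem_univ i)))
          have hu0 := hnot u v h hR
          have hv0 := hnot v u h.symm (by rwa [Sym2.eq_swap])
          exact ⟨h.1, hVW u h.2.1 hu0, hVW v h.2.2.1 hv0,
            hold u h.2.1 v h.2.2.1 hu0 hv0 h.2.2.2⟩
        · obtain ⟨i, hi, h⟩ := Finset.mem_image.1 (Finset.mem_coe.1 h)
          rw [← h]
          have hti := (hIt i).1 (Finset.mem_filter.1 hi).2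
          exact ⟨fun h => hti (hpw i i h).2, hpW i, hVW _ (hw i) (hw0 i), hpwe i⟩
        · obtain ⟨⟨i, j⟩, hi, h⟩ := Finset.mem_image.1 (Finset.mem_coe.1 h)
          rw [← h]
          have hij := (Finset.mem_filter.1 hi).2.1
          exact ⟨fun h => hij.ne (hpinj _ _ h), hpW i, hpW j, hpp i j hij.ne⟩
  have hRsub : (R : Set (Sym2 E)) ⊆ (exposedGraph V).edgeSet := by
    intro z hz
    obtain ⟨i, -, rfl⟩ := Finset.mem_image.1 (Finset.mem_coe.1 hz)
    exact ⟨(hw0 i).symm, hx₀, hw i, hnbr i⟩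
  have hRcard : (R : Set (Sym2 E)).ncard = 4 := by
    rw [ncard_coe_finset, Finset.card_image_of_injective, Finset.card_univ, Fintype.card_fin]
    exact fun i j hij => hwinj i j (Sym2.congr_right.1 hij)
  have hAcard : A.card = I.card := by
    refine Finset.card_image_of_injOn fun i hi j hj hij => ?_
    rcases Sym2.eq_iff.1 hij with ⟨h, -⟩ | ⟨h, -⟩
    · exact hpinj _ _ h
    · exact (hpw i j h).1
  have hBcard : B.card = J.card := by
    refine Finset.card_image_of_injOn ?_
    rintro ⟨i, j⟩ hx ⟨k, l⟩ hy hxy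
    have h1 := (Finset.mem_filter.1 (Finset.mem_coe.1 hx)).2.1
    have h2 := (Finset.mem_filter.1 (Finset.mem_coe.1 hy)).2.1
    rcases Sym2.eq_iff.1 hxy with ⟨h, h'⟩ | ⟨h, h'⟩
    · rw [Prod.mk.injEq]
      exact ⟨hpinj _ _ h, hpinj _ _ h'⟩
    · have h3 : i = l := hpinj _ _ h
      have h4 : j = k := hpinj _ _ h'
      subst h3 h4
      exact absurd h1 h2.asymm
  have hAdisj : Disjoint ((exposedGraph V).edgeSet \ (R : Set (Sym2 E))) (A : Set (Sym2 E)) := by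
    rw [Set.disjoint_right]
    intro z hz hz'
    obtain ⟨i, hi, rfl⟩ := Finset.mem_image.1 (Finset.mem_coe.1 hz)
    exact hnotV i (Finset.mem_filter.1 hi).2 hz'.1.2.1
  have hBdisj : Disjoint (((exposedGraph V).edgeSet \ (R : Set (Sym2 E))) ∪ A)
      (B : Set (Sym2 E)) := by
    rw [Set.disjoint_right]
    intro z hz hz'
    obtain ⟨⟨i, j⟩, hij, rfl⟩ := Finset.mem_image.1 (Finset.mem_coe.1 hz)
    rcases hz' with h | h
    · exact hnotV j (Finset.mem_filter.1 hij).2.2 h.1.2.2.1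
    · obtain ⟨k, hk, h⟩ := Finset.mem_image.1 (Finset.mem_coe.1 h)
      have htk := (hIt k).1 (Finset.mem_filter.1 hk).2
      rcases Sym2.eq_iff.1 h with ⟨-, h⟩ | ⟨-, h⟩
      exacts [htk (hpw _ _ h.symm).2, htk (hpw _ _ h.symm).2]
  have hfin := finite_edgeSet_exposedGraph V
  have hcount : (exposedGraph W).edgeSet.ncard + r + r.choose 2 = e + 6 := by
    rw [hedges, ncard_union_eq hBdisj ((hfin.sdiff).union A.finite_toSet) B.finite_toSet,
      ncard_union_eq hAdisj hfin.sdiff A.finite_toSet, ncard_coe_finset, ncard_coe_finset,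
      hAcard, hBcard]
    have h1 := ncard_sdiff_add_ncard_of_subset hRsub hfin
    rw [hRcard, hV.ncard_edgeSet] at h1
    omega
  have hWeq : W = V.erase x₀ ∪ I.image p := by
    ext u
    constructor
    · intro hu
      rcases hWcases u hu with ⟨i, rfl⟩ | h
      · by_cases hi : t i = 1
        · exact Finset.mem_union_left _ (Finset.mem_erase.2 ⟨hp0 i, hpV' i hi⟩)
        · exact Finset.mem_union_right _ (Finset.mem_image_of_mem p
            (Finset.mem_filter.2 ⟨Finset.mem_univ i, (hIt i).2 hi⟩))
      · exact Finset.mem_union_left _ (Finset.mem_erase.2 ⟨h.2.1, h.1⟩)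
    · exact fun hu => Finset.union_subset_union_right
        (Finset.image_subset_image (Finset.subset_univ I)) hu
  have hWcard : W.card + r = m + 3 := by
    rw [hWeq, Finset.card_union_of_disjoint, Finset.card_image_of_injective _ hpinj,
      Finset.card_erase_of_mem hx₀, hV.card_eq]
    · have : 0 < V.card := Finset.card_pos.2 ⟨x₀, hx₀⟩
      rw [hV.card_eq] at this
      omega
    · rw [Finset.disjoint_right]
      intro u hu hu'
      obtain ⟨i, hi, rfl⟩ := Finset.mem_image.1 hu
      exact hnotV i (Finset.mem_filter.1 hi).2 (Finset.mem_of_mem_erase hu')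
  have ht3 : 0 < t 3 - 1 := by
    have : t 3 ≠ 1 := (hIt 3).1 (by simp; omega)
    exact sub_pos.2 (lt_of_le_of_ne (ht1 3) this.symm)
  have hσW : ∀ u ∈ W, (∃ i, u = p i) ∨ 1 < ∑ i, c i (u - x₀) := fun u hu =>
    (hWcases u hu).imp_right fun h => hcut u h.1 h.2.1 h.2.2
  have hσp : ∀ i, ∑ k, c k (p i - x₀) = 1 := fun i => by simp [hcp]
  refine ⟨W, W.card, _, hWcard, hcount, ⟨rfl, rfl, ?_, ?_⟩, ?_, ?_⟩
  · intro u hu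
    rcases hWcases u hu with ⟨i, rfl⟩ | ⟨h1, h2, h3⟩
    · obtain ⟨j, hj⟩ := exists_ne i
      exact ⟨p j, fun h => hj (hpinj _ _ h.symm), hpW i, hpW j, hpp i j hj.symm⟩
    · obtain ⟨v, hv⟩ := hV.exists_adj u h1
      by_cases hv0 : v = x₀
      · subst hv0
        obtain ⟨i, rfl⟩ := hnbr' u h1 h2 hv.symm.2.2.2
        have h : (exposedGraph W).Adj (p i) (w i) := ⟨(h3 i).symm, hpW i, hu, hpwe i⟩
        exact ⟨p i, h.symm⟩
      · exact ⟨v, hv.1, hu, hVW v hv.2.2.1 hv0, hold u h1 v hv.2.2.1 h2 hv0 hv.2.2.2⟩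
  · rw [eq_top_iff, ← b.span_eq, Submodule.span_le]
    have h3 : b 3 ∈ vectorSpan ℝ (W : Set E) := by
      have h4 := vsub_mem_vectorSpan ℝ (Finset.mem_coe.2 (hVW _ (hw 3) (hw0 3)))
        (Finset.mem_coe.2 (hpW 3))
      have h5 : w 3 -ᵥ p 3 = (t 3 - 1) • b 3 := by simp only [w, p, vsub_eq_sub]; module
      rw [← inv_smul_smul₀ ht3.ne' (b 3), ← h5]
      exact Submodule.smul_mem _ _ h4
    rintro _ ⟨i, rfl⟩
    have h4 := vsub_mem_vectorSpan ℝ (Finset.mem_coe.2 (hpW i)) (Finset.mem_coe.2 (hpW 3))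
    have h5 : b i = (p i -ᵥ p 3) + b 3 := by simp only [p, vsub_eq_sub]; module
    rw [h5]
    exact Submodule.add_mem _ h4 h3
  · refine ⟨x₀, b, -1, by norm_num, hpW, fun u hu => (hσW u hu).imp_right fun h => ?_⟩
    simp only [hc] at h
    linarith
  · let b' : Fin 4 → E := fun i => if i = 3 then (t 3 - 1) • b 3 else b i - b 3
    let c' : Fin 4 → E →ₗ[ℝ] ℝ := fun i => if i = 3 then (t 3 - 1)⁻¹ • ∑ k, c k else c i
    have hdual : ∀ i j, c' i (b' j) = if i = j then 1 else 0 := by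
      intro i j
      fin_cases i <;> fin_cases j <;>
        simp [b', c', hcb, Fin.sum_univ_four, ht3.ne']
    obtain ⟨D, hD, hDc⟩ := exists_basis_of_dual b b' c' hdual
    have hD3 : p 3 + D 3 = w 3 := by simp only [hD, b', if_true, p, w]; module
    have hDi : ∀ i, i ≠ 3 → p 3 + D i = p i := fun i hi => by
      simp only [hD, b', if_neg hi, p]; module
    have hu3 : ∀ u, u - p 3 = (u - x₀) - b 3 := fun u => by simp only [p]; abel
    have hDci : ∀ i, i ≠ 3 → ∀ u, D.coord i (u - p 3) = c i (u - x₀) := fun i hi u => by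
      simp only [hDc, c', if_neg hi, hu3, map_sub _ (u - x₀), hcb, sub_zero]
    have hDc3 : ∀ u, D.coord 3 (u - p 3) = (t 3 - 1)⁻¹ * (∑ k, c k (u - x₀) - 1) := fun u => by
      simp only [hDc, c', if_true, hu3, map_sub _ (u - x₀), LinearMap.smul_apply, smul_eq_mul,
        LinearMap.sum_apply, hcb]
      simp
      ring
    have hzero : ∀ u ∈ W, D.coord 3 (u - p 3) = 0 → ∃ i, u = p i := by
      intro u hu h
      refine (hσW u hu).resolve_right fun h1 => ?_
      rw [hDc3] at h
      have := mul_pos (inv_pos.2 ht3) (sub_pos.2 h1)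
      exact this.ne' h
    refine ⟨p 3, hpW 3, D, fun i => ?_, fun u hu i => ?_, fun u hu h2 h3 => ?_,
      fun i u hu h => ?_, ?_⟩
    · by_cases hi : i = 3
      · rw [hi, hD3]; exact hVW _ (hw 3) (hw0 3)
      · rw [hDi i hi]; exact hpW i
    · by_cases hi : i = 3
      · rw [hi, hDc3]
        refine mul_nonneg (inv_nonneg.2 ht3.le) (sub_nonneg.2 ?_)
        rcases hσW u hu with ⟨j, rfl⟩ | h
        exacts [(hσp j).ge, h.le]
      · rw [hDci i hi]; exact hWnn u hu i
    · obtain ⟨i, rfl⟩ := hzero u hu h3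
      rw [hDci 2 (by decide), hcp] at h2
      rw [hDi 0 (by decide), hDi 1 (by decide)]
      fin_cases i
      · exact Or.inr (Or.inl rfl)
      · exact Or.inr (Or.inr rfl)
      · simp at h2
      · exact Or.inl rfl
    · by_cases hi : i = 3
      · subst hi
        rw [hD3]
        rcases hWcases u hu with ⟨j, rfl⟩ | h1
        · by_cases hj : j = 3
          · exact Or.inl (by rw [hj])
          · have := h j hj
            rw [hDci j hj, hcp, if_pos rfl] at this
            exact absurd this one_ne_zero
        · refine Or.inr ((hray 3 u h1.1 fun j hj => ?_).resolve_left h1.2.1)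
          have := h j hj
          rwa [hDci j hj] at this
      · obtain ⟨j, rfl⟩ := hzero u hu (h 3 (Ne.symm hi))
        rw [hDi i hi]
        by_cases hji : j = i
        · exact Or.inr (by rw [hji])
        by_cases hj : j = 3
        · exact Or.inl (by rw [hj])
        have := h j hji
        rw [hDci j hj, hcp, if_pos rfl] at this
        exact absurd this one_ne_zero
    · rw [hDi 0 (by decide), hDi 1 (by decide)]
      exact hpp 0 1 (by decide)

/-- Cutting off a simple vertex by a hyperplane through `r ≤ 2` of its neighbours. -/
lemma Realizes.truncate [DecidableEq E] {V : Finset E} {m e r : ℕ} (hV : Realizes V m e)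
    (hS : HasSimpleVertex V) (hr : r ≤ 2) :
    ∃ (W : Finset E) (m' e' : ℕ), m' + r = m + 3 ∧ e' + r + r.choose 2 = e + 6 ∧
      Realizes W m' e' ∧ HasSimplexFacet W ∧ HasSimpleVertex W := by
  obtain ⟨x₀, hx₀, b, hb, hnn, htri, hray, hex⟩ := hS
  have hcb : ∀ i j, b.coord i (b j) = if i = j then 1 else 0 := b.coord_self_eq_ite
  have hev : ∀ᶠ ε in 𝓝[>] (0 : ℝ), ∀ u ∈ V, u ≠ x₀ → (∀ i : Fin 4, (i : ℕ) < r → u ≠ x₀ + b i) →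
      0 < ∑ i : Fin 4, (if (i : ℕ) < r then ε * b.coord i (u - x₀) else b.coord i (u - x₀)) - ε := by
    simp only [Finset.eventually_all, eventually_all]
    intro u hu hu0 hub
    have hc : Continuous fun ε : ℝ => ∑ i : Fin 4,
        (if (i : ℕ) < r then ε * b.coord i (u - x₀) else b.coord i (u - x₀)) - ε := by
      refine Continuous.sub (continuous_finsetSum _ fun i _ => ?_) continuous_id
      split_ifs <;> fun_prop
    refine (hc.continuousAt.eventually (lt_mem_nhds ?_)).filter_mono nhdsWithin_le_nhds
    have hnn' : ∀ i ∈ Finset.univ, 0 ≤ if (i : Fin 4).val < r then 0 * b.coord i (u - x₀)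
        else b.coord i (u - x₀) := fun i _ => by
      split_ifs
      · simp
      · exact hnn u hu i
    change 0 < ∑ i : Fin 4, (if (i : ℕ) < r then 0 * b.coord i (u - x₀)
      else b.coord i (u - x₀)) - 0
    rw [sub_zero]
    by_contra hcon
    have h0 := (Finset.sum_eq_zero_iff_of_nonneg hnn').1
      (le_antisymm (not_lt.1 hcon) (Finset.sum_nonneg hnn'))
    have hz : ∀ i : Fin 4, r ≤ i → b.coord i (u - x₀) = 0 := fun i hi => by
      have := h0 i (Finset.mem_univ i)
      rwa [if_neg (not_lt.2 hi)] at this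
    have hb' : ∀ i : Fin 4, u = x₀ + b i → False := fun i h => by
      by_cases hi : (i : ℕ) < r
      · exact hub i hi h
      · have := hz i (not_lt.1 hi)
        rw [h, add_sub_cancel_left, hcb, if_pos rfl] at this
        exact one_ne_zero this
    rcases htri u hu (hz 2 hr) (hz 3 (hr.trans (by decide))) with h | h | h
    exacts [hu0 h, hb' 0 h, hb' 1 h]
  obtain ⟨ε, hε, hε1, hε0⟩ := (hev.and ((eventually_lt_nhds (b := (1 : ℝ)) one_pos).filter_mono
    nhdsWithin_le_nhds |>.and self_mem_nhdsWithin)).exists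
  replace hε0 : 0 < ε := hε0
  let τ : Fin 4 → ℝ := fun i => if (i : ℕ) < r then 1 else ε
  have hτ0 : ∀ i, 0 < τ i := fun i => by simp only [τ]; split_ifs <;> linarith
  have hτ1 : ∀ i, τ i ≤ 1 := fun i => by simp only [τ]; split_ifs <;> linarith
  obtain ⟨B, hB, hBc⟩ := exists_basis_of_dual b (fun i => τ i • b i)
    (fun i => (τ i)⁻¹ • b.coord i) (fun i j => by
      simp only [LinearMap.smul_apply, map_smul, hcb, smul_eq_mul]
      split_ifs with h
      · rw [h, mul_one, mul_inv_cancel₀ (hτ0 j).ne']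
      · simp)
  replace hBc : ∀ i x, B.coord i x = (τ i)⁻¹ * b.coord i x := hBc
  have htB : ∀ i, (τ i)⁻¹ • B i = b i := fun i => by
    rw [hB, inv_smul_smul₀ (hτ0 i).ne']
  refine hV.truncate_aux hx₀ B (fun i => (τ i)⁻¹) (fun i => (one_le_inv₀ (hτ0 i)).2 (hτ1 i))
    (fun i => by rw [htB]; exact hb i)
    (fun u hu i => by rw [hBc]; exact mul_nonneg (inv_nonneg.2 (hτ0 i).le) (hnn u hu i))
    (fun u hu hu0 hub => ?_)
    (fun i u hu h => by
      rw [htB]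
      refine hray i u hu fun j hj => ?_
      have := h j hj
      rw [hBc] at this
      exact (mul_eq_zero.1 this).resolve_left (inv_ne_zero (hτ0 j).ne'))
    hr (fun i => ?_) (fun h2 => ?_)
  · have h1 := hε u hu hu0 (fun i hi => by
      have := hub i
      rw [hB] at this
      simpa only [τ, if_pos hi, one_smul] using this)
    have h2 : ∑ i : Fin 4, (if (i : ℕ) < r then ε * b.coord i (u - x₀) else b.coord i (u - x₀)) =
        ε * ∑ i, B.coord i (u - x₀) := by
      rw [Finset.mul_sum]
      refine Finset.sum_congr rfl fun i _ => ?_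
      rw [hBc]
      simp only [τ]
      split_ifs
      · rw [inv_one, one_mul]
      · rw [mul_inv_cancel_left₀ hε0.ne']
    rw [h2] at h1
    by_contra hcon
    nlinarith
  · rw [inv_eq_one]
    simp only [τ]
    split_ifs with h
    · simp [h]
    · simp [h, hε1.ne]
  · have h0 : B 0 = b 0 := by rw [hB]; simp only [τ]; rw [if_pos (by simp; omega), one_smul]
    have h1 : B 1 = b 1 := by rw [hB]; simp only [τ]; rw [if_pos (by simp; omega), one_smul]
    rwa [h0, h1]

end Truncation

section Curve

open Module Filter Topology

/-- A curve of degree four, affinely equivalent to the moment curve. -/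
noncomputable def curvePoint (t : ℝ) : Fin 4 → ℝ :=
  ![t, (t - 1) * (t - 2), (t - 1) * (t - 2) * t, (t - 1) * (t - 2) * t ^ 2]

/-- A point close to the midpoint of `curvePoint 1` and `curvePoint 2`. -/
noncomputable def nearMidpoint (κ v : ℝ) : Fin 4 → ℝ :=
  ![3 / 2, κ, κ * ((5 / 2 + v) / 2), κ * (5 / 2 * v)]

/-- The linear form with the given coefficients. -/
noncomputable def coeffForm (a b c d : ℝ) : (Fin 4 → ℝ) →ₗ[ℝ] ℝ :=
  a • LinearMap.proj 0 + b • LinearMap.proj 1 + c • LinearMap.proj 2 + d • LinearMap.proj 3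

lemma coeffForm_apply (a b c d : ℝ) (y : Fin 4 → ℝ) :
    coeffForm a b c d y = a * y 0 + b * y 1 + c * y 2 + d * y 3 := by
  simp [coeffForm]

lemma linearMap_apply_fin_four (φ : (Fin 4 → ℝ) →ₗ[ℝ] ℝ) :
    ∃ a b c d : ℝ, φ = coeffForm a b c d := by
  refine ⟨φ (Pi.single 0 1), φ (Pi.single 1 1), φ (Pi.single 2 1), φ (Pi.single 3 1), ?_⟩
  ext i
  fin_cases i <;> simp [coeffForm_apply]

lemma coeffForm_curvePoint (a b c d t : ℝ) : coeffForm a b c d (curvePoint t) =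
    a * t + (t - 1) * (t - 2) * (b + c * t + d * t ^ 2) := by
  simp [coeffForm_apply, curvePoint]; ring

lemma coeffForm_nearMidpoint (a b c d κ v : ℝ) : coeffForm a b c d (nearMidpoint κ v) =
    a * (3 / 2) + κ * (b + c * ((5 / 2 + v) / 2) + d * (5 / 2 * v)) := by
  simp [coeffForm_apply, nearMidpoint]; ring

lemma curvePoint_injective : Function.Injective curvePoint := fun s t h => by
  simpa [curvePoint] using congrFun h 0

lemma vectorSpan_eq_top_of_forall {V : Set (Fin 4 → ℝ)} {x₀ : Fin 4 → ℝ} (hx₀ : x₀ ∈ V)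
    (h : ∀ a b c d : ℝ, (∀ x ∈ V, coeffForm a b c d x = coeffForm a b c d x₀) →
      a = 0 ∧ b = 0 ∧ c = 0 ∧ d = 0) : vectorSpan ℝ V = ⊤ := by
  by_contra hne
  obtain ⟨f, hf, hle⟩ := Submodule.exists_le_ker_of_lt_top _ (lt_top_iff_ne_top.2 hne)
  obtain ⟨a, b, c, d, rfl⟩ := linearMap_apply_fin_four f
  obtain ⟨rfl, rfl, rfl, rfl⟩ := h a b c d fun x hx => by
    have := hle (vsub_mem_vectorSpan ℝ hx hx₀)
    rw [LinearMap.mem_ker, vsub_eq_sub, map_sub] at this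
    exact sub_eq_zero.1 this
  exact hf (LinearMap.ext fun y => by simp [coeffForm_apply])

lemma nat_sub_mul_sub_nonneg (i : ℕ) (hi : 1 ≤ i) : (0 : ℝ) ≤ ((i : ℝ) - 1) * (i - 2) := by
  rcases hi.eq_or_lt with rfl | h
  · simp
  · have : (2 : ℝ) ≤ i := by exact_mod_cast h
    nlinarith

/-- The vertices of a cyclic polytope, together with one further point. -/
noncomputable def augmentedCyclic (k : ℕ) (p : Fin 4 → ℝ) : Finset (Fin 4 → ℝ) :=
  insert p ((Finset.Icc 1 k).image fun i : ℕ => curvePoint i)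

variable {k j : ℕ} {κ : ℝ}

lemma curvePoint_mem_augmentedCyclic {p : Fin 4 → ℝ} {i : ℕ} (h1 : 1 ≤ i) (hk : i ≤ k) :
    curvePoint i ∈ augmentedCyclic k p :=
  Finset.mem_insert_of_mem (Finset.mem_image.2 ⟨i, Finset.mem_Icc.2 ⟨h1, hk⟩, rfl⟩)

lemma eq_or_of_mem_augmentedCyclic {p u : Fin 4 → ℝ} (hu : u ∈ augmentedCyclic k p) :
    u = p ∨ ∃ i : ℕ, 1 ≤ i ∧ i ≤ k ∧ u = curvePoint i := by
  rcases Finset.mem_insert.1 hu with h | h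
  · exact Or.inl h
  · obtain ⟨i, hi, rfl⟩ := Finset.mem_image.1 h
    exact Or.inr ⟨i, (Finset.mem_Icc.1 hi).1, (Finset.mem_Icc.1 hi).2, rfl⟩

lemma curvePoint_ne_nearMidpoint (i : ℕ) (κ v : ℝ) : curvePoint i ≠ nearMidpoint κ v := fun h => by
  have h : (i : ℝ) = 3 / 2 := by simpa [curvePoint, nearMidpoint] using congrFun h 0
  have h : ((2 * i : ℕ) : ℝ) = (3 : ℕ) := by push_cast; linarith
  have := Nat.cast_injective h
  omega

/-- For small `κ`, all pairs of points on the curve are exposed. -/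
lemma eventually_exposed_curvePoint (k : ℕ) {v : ℝ} (hv : 2 < v) :
    ∀ᶠ κ in 𝓝[>] (0 : ℝ), ∀ s ∈ Finset.Icc 1 k, ∀ t ∈ Finset.Icc 1 k, s < t →
      Exposed (augmentedCyclic k (nearMidpoint κ v)) (curvePoint s) (curvePoint t) := by
  simp only [Finset.eventually_all, eventually_all]
  intro s hs t ht hst
  set S : ℝ := s + t with hS
  set P : ℝ := s * t with hP
  set Q1 : ℝ := (1 - s) ^ 2 * (1 - t) ^ 2 with hQ1
  set Q2 : ℝ := (2 - s) ^ 2 * (2 - t) ^ 2 with hQ2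
  set m : ℝ := 5 / 2 * v + (3 - 2 * S) * ((5 / 2 + v) / 2) + (S ^ 2 + 2 * P + 7 - 6 * S) with hm
  have hs1 : (1 : ℝ) ≤ s := by exact_mod_cast (Finset.mem_Icc.1 hs).1
  have hst' : (s : ℝ) + 1 ≤ t := by exact_mod_cast hst
  have hL : ∀ᶠ κ in 𝓝[>] (0 : ℝ), 0 < (Q1 + Q2) / 2 + κ * m := by
    by_cases h : 0 < Q1 + Q2
    · have hc : Continuous fun κ : ℝ => (Q1 + Q2) / 2 + κ * m := by fun_prop
      refine (hc.continuousAt.eventually (lt_mem_nhds ?_)).filter_mono nhdsWithin_le_nhds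
      simpa using h
    · have h1 : 0 ≤ Q1 := by positivity
      have h2 : 0 ≤ Q2 := by positivity
      have h1' : Q1 = 0 := by linarith
      have h2' : Q2 = 0 := by linarith
      have hs : (s : ℝ) = 1 := by
        rw [hQ1, ← mul_pow, sq_eq_zero_iff, mul_eq_zero] at h1'
        rcases h1' with h | h <;> linarith
      have ht : (t : ℝ) = 2 := by
        rw [hQ2, hs, ← mul_pow, sq_eq_zero_iff, mul_eq_zero] at h2'
        rcases h2' with h | h <;> linarith
      have hm0 : 0 < m := by rw [hm, hS, hP, hs, ht]; linarith
      filter_upwards [self_mem_nhdsWithin] with κ hκ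
      have : 0 < κ * m := mul_pos hκ hm0
      linarith
  filter_upwards [hL] with κ hκ
  let φ := coeffForm (Q2 - Q1) (S ^ 2 + 2 * P + 7 - 6 * S) (3 - 2 * S) 1
  have hφ : ∀ i : ℝ, φ (curvePoint i) = (i - s) ^ 2 * (i - t) ^ 2 - (2 * Q1 - Q2) := by
    intro i
    simp only [φ, coeffForm_curvePoint, hQ1, hQ2, hS, hP]
    ring
  refine ⟨φ, by rw [hφ, hφ]; ring, fun u hu hus hut => ?_⟩
  rw [hφ, sub_self]
  rcases eq_or_of_mem_augmentedCyclic hu with rfl | ⟨i, -, -, rfl⟩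
  · simp only [φ, coeffForm_nearMidpoint]
    rw [hm] at hκ
    linarith
  · rw [hφ]
    have h1 : (i : ℝ) - s ≠ 0 := fun h => hus (by rw [sub_eq_zero.1 h])
    have h2 : (i : ℝ) - t ≠ 0 := fun h => hut (by rw [sub_eq_zero.1 h])
    have : 0 < ((i : ℝ) - s) ^ 2 * (i - t) ^ 2 := by positivity
    linarith

lemma exposed_nearMidpoint (hj : 4 ≤ j) (hκ : 0 < κ) {t : ℕ} (ht1 : 1 ≤ t)
    (htj : t ≤ j) :
    Exposed (augmentedCyclic k (nearMidpoint κ (j + 1 / 4))) (nearMidpoint κ (j + 1 / 4))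
      (curvePoint t) := by
  have hj' : (4 : ℝ) ≤ j := by exact_mod_cast hj
  have ht1' : (1 : ℝ) ≤ t := by exact_mod_cast ht1
  have htj' : (t : ℝ) ≤ j := by exact_mod_cast htj
  obtain ⟨w, hw1, hw2⟩ : ∃ w : ℝ, (5 / 2 - w) * (j + 1 / 4 - w) < 0 ∧
      ((t : ℝ) - 1) * (t - 2) * (t - w) ^ 2 = 0 := by
    by_cases h : t ≤ 2
    · refine ⟨7 / 2, by nlinarith, ?_⟩
      interval_cases t <;> norm_num
    · have : (3 : ℝ) ≤ t := by exact_mod_cast not_le.1 h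
      exact ⟨t, by nlinarith, by ring⟩
  set D : ℝ := κ + ((1 - t) ^ 2 + (2 - t) ^ 2) / 2 with hD
  have hD0 : 0 < D := by positivity
  obtain ⟨σ, hσ, hσD⟩ : ∃ σ : ℝ, 0 < σ ∧ σ * D = -(κ * ((5 / 2 - w) * (j + 1 / 4 - w))) := by
    refine ⟨-(κ * ((5 / 2 - w) * (j + 1 / 4 - w))) / D, div_pos ?_ hD0, div_mul_cancel₀ _ hD0.ne'⟩
    nlinarith
  let φ := coeffForm (σ * (3 - 2 * t)) (w ^ 2 + σ) (-2 * w) 1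
  have hφ : ∀ i : ℝ, φ (curvePoint i) =
      (i - 1) * (i - 2) * (i - w) ^ 2 + σ * (i - t) ^ 2 - σ * (t ^ 2 - 2) := by
    intro i
    simp only [φ, coeffForm_curvePoint]
    ring
  have hφp : φ (nearMidpoint κ (j + 1 / 4)) = - σ * (t ^ 2 - 2) := by
    simp only [φ, coeffForm_nearMidpoint]
    rw [hD] at hσD
    linear_combination hσD
  refine ⟨φ, ?_, fun u hu hup hut => ?_⟩
  · rw [hφ, hφp, hw2]; ring
  · obtain ⟨i, hi, -, rfl⟩ := (eq_or_of_mem_augmentedCyclic hu).resolve_left hup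
    rw [hφ, hφp]
    have h1 : (i : ℝ) - t ≠ 0 := fun h => hut (by rw [sub_eq_zero.1 h])
    have h2 := mul_nonneg (nat_sub_mul_sub_nonneg i hi) (sq_nonneg ((i : ℝ) - w))
    have : 0 < σ * ((i : ℝ) - t) ^ 2 := by positivity
    linarith

lemma eventually_not_exposed_nearMidpoint (hj : 4 ≤ j) (hjk : j ≤ k) :
    ∀ᶠ κ in 𝓝[>] (0 : ℝ), ∀ s ∈ Finset.Icc (j + 1) k,
      ¬ Exposed (augmentedCyclic k (nearMidpoint κ (j + 1 / 4))) (nearMidpoint κ (j + 1 / 4))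
        (curvePoint s) := by
  simp only [Finset.eventually_all]
  intro s hs
  have hj' : (4 : ℝ) ≤ j := by exact_mod_cast hj
  have hsj : (j : ℝ) + 1 ≤ s := by exact_mod_cast (Finset.mem_Icc.1 hs).1
  obtain ⟨A, hA⟩ : ∃ A : ℝ, (j : ℝ) = A + 5 / 2 := ⟨j - 5 / 2, by ring⟩
  obtain ⟨B, hB⟩ : ∃ B : ℝ, (s : ℝ) = A + B + 5 / 2 := ⟨s - A - 5 / 2, by ring⟩
  have hA1 : 3 / 2 ≤ A := by linarith
  have hB1 : 1 ≤ B := by linarith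
  -- the coefficients of an affine dependence, up to a factor `κ`
  obtain ⟨δ, hδ, hδe⟩ : ∃ δ : ℝ, 0 < δ ∧ δ * ((s - 1) * (s - 2) * (s - 3) * (s - j)) =
      -((5 / 2 - 3) * (1 / 4) + (5 / 2 - j) * (j + 1 / 4 - 3)) / 2 := by
    have h : (0 : ℝ) < (s - 1) * (s - 2) * (s - 3) * (s - j) := by
      have h1 : (0 : ℝ) < s - 1 := by linarith
      have h2 : (0 : ℝ) < s - 2 := by linarith
      have h3 : (0 : ℝ) < s - 3 := by linarith
      have h4 : (0 : ℝ) < s - j := by linarith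
      positivity
    refine ⟨_ / _, div_pos ?_ h, div_mul_cancel₀ _ h.ne'⟩
    rw [hA]
    nlinarith
  obtain ⟨γ, hγ, hγe⟩ : ∃ γ : ℝ, 0 < γ ∧ γ * (2 * (j - 3) * (s - 3)) =
      ((5 / 2 - j) * (j + 1 / 4 - s) + (5 / 2 - s) * (1 / 4)) / 2 := by
    have h : (0 : ℝ) < 2 * (j - 3) * (s - 3) := by
      have h3 : (0 : ℝ) < s - 3 := by linarith
      have h4 : (0 : ℝ) < (j : ℝ) - 3 := by linarith
      positivity
    refine ⟨_ / _, div_pos ?_ h, div_mul_cancel₀ _ h.ne'⟩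
    rw [hB, hA]
    nlinarith
  obtain ⟨η, hη, hηe⟩ : ∃ η : ℝ, 0 < η ∧ η * ((j - 1) * (j - 2) * (j - 3) * (s - j)) =
      -((5 / 2 - 3) * (j + 1 / 4 - s) + (5 / 2 - s) * (j + 1 / 4 - 3)) / 2 := by
    have h : (0 : ℝ) < (j - 1) * (j - 2) * (j - 3) * (s - j) := by
      have h1 : (0 : ℝ) < (j : ℝ) - 1 := by linarith
      have h2 : (0 : ℝ) < (j : ℝ) - 2 := by linarith
      have h3 : (0 : ℝ) < (j : ℝ) - 3 := by linarith
      have h4 : (0 : ℝ) < s - j := by linarith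
      positivity
    refine ⟨_ / _, div_pos ?_ h, div_mul_cancel₀ _ h.ne'⟩
    rw [hB, hA]
    nlinarith
  have hev : ∀ m : ℝ, ∀ᶠ κ in 𝓝[>] (0 : ℝ), 0 < 1 / 2 + κ * m := fun m => by
    have hc : Continuous fun κ : ℝ => 1 / 2 + κ * m := by fun_prop
    refine (hc.continuousAt.eventually (lt_mem_nhds ?_)).filter_mono nhdsWithin_le_nhds
    norm_num
  filter_upwards [hev (-δ * (s - 2) + γ + η * (j - 2)),
    hev (δ * (s - 1) - 2 * γ - η * (j - 1)), self_mem_nhdsWithin] with κ hα1 hα2 hκ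
  replace hκ : 0 < κ := hκ
  have hK : ((s : ℝ) - 3) * (j - 3) * (s - j) ≠ 0 :=
    mul_ne_zero (mul_ne_zero (by linarith) (by linarith)) (by linarith)
  have e1 : 1 + δ * ((s - 1) * (s - 2)) = 2 * γ + η * ((j - 1) * (j - 2)) := by
    refine mul_left_cancel₀ hK ?_
    linear_combination (j - 3) * hδe - (s - j) * hγe - (s - 3) * hηe
  have e2 : (5 / 2 + (j + 1 / 4 : ℝ)) / 2 + δ * ((s - 1) * (s - 2)) * s =
      6 * γ + η * ((j - 1) * (j - 2)) * j := by
    refine mul_left_cancel₀ hK ?_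
    linear_combination (j - 3) * s * hδe - (s - j) * 3 * hγe - (s - 3) * j * hηe
  have e3 : 5 / 2 * (j + 1 / 4 : ℝ) + δ * ((s - 1) * (s - 2)) * s ^ 2 =
      18 * γ + η * ((j - 1) * (j - 2)) * j ^ 2 := by
    refine mul_left_cancel₀ hK ?_
    linear_combination (j - 3) * s ^ 2 * hδe - (s - j) * 9 * hγe - (s - 3) * j ^ 2 * hηe
  rintro ⟨φ, hφ, hpos⟩
  set p := nearMidpoint κ (j + 1 / 4)
  have hne : ∀ i : ℕ, 1 ≤ i → i ≤ j → φ p < φ (curvePoint i) := fun i hi hij =>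
    hpos _ (curvePoint_mem_augmentedCyclic hi (hij.trans hjk)) (curvePoint_ne_nearMidpoint _ _ _)
      fun h => by
        have h : (i : ℝ) = s := curvePoint_injective h
        have : (i : ℝ) ≤ j := by exact_mod_cast hij
        linarith
  have h1 := mul_pos hα1 (sub_pos.2 (hne 1 le_rfl (by omega)))
  have h2 := mul_pos hα2 (sub_pos.2 (hne 2 (by omega) (by omega)))
  have h3 := mul_pos (mul_pos hκ hγ) (sub_pos.2 (hne 3 (by omega) (by omega)))
  have h4 := mul_pos (mul_pos hκ hη) (sub_pos.2 (hne j (by omega) le_rfl))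
  have h5 : κ * δ * (φ (curvePoint s) - φ p) = 0 := by rw [hφ]; ring
  have h6 := add_pos (add_pos h1 h2) (add_pos h3 h4)
  clear hpos hne h1 h2 h3 h4 hev
  obtain ⟨a, b, c, d, rfl⟩ := linearMap_apply_fin_four φ
  simp only [p, coeffForm_curvePoint, coeffForm_nearMidpoint] at h5 h6
  push_cast at h5 h6
  refine h6.ne ?_
  linear_combination -h5 + κ * b * e1 + κ * c * e2 + κ * d * e3

end Curve

section Families

open Module Filter Topology

lemma hasSimplexFacet_augmentedCyclic {k j : ℕ} {κ : ℝ} (hj : 4 ≤ j) (hjk : j ≤ k) (hκ : 0 < κ) :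
    HasSimplexFacet (augmentedCyclic k (nearMidpoint κ (j + 1 / 4))) := by
  have hj' : (4 : ℝ) ≤ j := by exact_mod_cast hj
  have hjk' : (j : ℝ) ≤ k := by exact_mod_cast hjk
  have h1 : (k : ℝ) - 1 ≠ 0 := by linarith
  have h2 : (k : ℝ) - 2 ≠ 0 := by linarith
  have h3 : (k : ℝ) - 3 ≠ 0 := by linarith
  set p := nearMidpoint κ (j + 1 / 4) with hp
  let x₀ : Fin 4 → ℝ := ![1, 0, 0, 1]
  let t : Fin 4 → ℕ := ![1, 2, 3, k]
  -- the coordinates, as linear forms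
  let c2 := coeffForm 0 (k / (2 * (k - 3))) (-1 / (2 * (k - 3))) 0
  let c3 := coeffForm 0 (-3 / ((k - 1) * (k - 2) * (k - 3))) (1 / ((k - 1) * (k - 2) * (k - 3))) 0
  let c1 := coeffForm 1 0 0 0 - 2 • c2 - (k - 1 : ℝ) • c3
  let σ : (Fin 4 → ℝ) →ₗ[ℝ] ℝ :=
    -coeffForm 0 0 0 1 + (18 : ℝ) • c2 + ((k - 1) * (k - 2) * k ^ 2 : ℝ) • c3
  let c : Fin 4 → (Fin 4 → ℝ) →ₗ[ℝ] ℝ := ![σ - c1 - c2 - c3, c1, c2, c3]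
  have hσ : ∀ y, ∑ i, c i y = σ y := fun y => by
    simp [c, Fin.sum_univ_four]
    ring
  have hσ' : ∀ y, σ y = -y 3 + (k + 3) * y 2 - 3 * k * y 1 := by
    intro y
    simp only [σ, c2, c3, LinearMap.add_apply, LinearMap.smul_apply, coeffForm_apply,
      smul_eq_mul, LinearMap.neg_apply]
    field_simp
    ring
  obtain ⟨B, hB, hBc⟩ := exists_basis_of_dual (Pi.basisFun ℝ (Fin 4))
    (fun i => curvePoint (t i) - x₀) c (fun i j => by
      fin_cases i <;> fin_cases j <;>
        simp [c, t, x₀, σ, c1, c2, c3, coeffForm_apply, curvePoint] <;>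
        field_simp <;> ring)
  have hBt : ∀ i, x₀ + B i = curvePoint (t i) := fun i => by rw [hB, add_sub_cancel]
  have hmem : ∀ i : ℕ, 1 ≤ i → i ≤ k → curvePoint i ∈ augmentedCyclic k p :=
    fun i => curvePoint_mem_augmentedCyclic
  refine ⟨x₀, B, -1, by norm_num, fun i => ?_, fun u hu => ?_⟩
  · rw [hBt]
    have ht : 1 ≤ t i ∧ t i ≤ k := by
      fin_cases i <;> simp [t] <;> omega
    exact hmem _ ht.1 ht.2
  · simp only [hBc, hσ, hBt]
    rcases eq_or_of_mem_augmentedCyclic hu with rfl | ⟨i, hi, hik, rfl⟩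
    · right
      rw [hσ']
      have h : 5 / 2 * (j + 1 / 4 : ℝ) - (k + 3) * ((5 / 2 + (j + 1 / 4)) / 2) + 3 * k < 0 := by
        nlinarith [mul_nonneg (sub_nonneg.2 hjk') (by linarith : (0 : ℝ) ≤ j - 13 / 4),
          sq_nonneg ((j : ℝ) - 4)]
      have h := mul_neg_of_pos_of_neg hκ h
      simp [hp, nearMidpoint, x₀]
      linarith
    · by_cases hit : ∃ l, i = t l
      · exact Or.inl (hit.imp fun l h => by rw [h])
      · right
        push Not at hit
        have hi1 := hit 0
        have hi2 := hit 1
        have hi3 := hit 2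
        have hi4 := hit 3
        simp only [t, Matrix.cons_val_zero, Matrix.cons_val_one, Matrix.cons_val] at hi1 hi2 hi3 hi4
        have hi5 : (4 : ℝ) ≤ i := by exact_mod_cast (by omega : 4 ≤ i)
        have hi6 : (i : ℝ) + 1 ≤ k := by exact_mod_cast (by omega : i + 1 ≤ k)
        rw [hσ']
        have h : 0 < ((i : ℝ) - 1) * (i - 2) * (i - 3) * (k - i) := by
          have a1 : (0 : ℝ) < i - 1 := by linarith
          have a2 : (0 : ℝ) < i - 2 := by linarith
          have a3 : (0 : ℝ) < i - 3 := by linarith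
          have a4 : (0 : ℝ) < k - i := by linarith
          positivity
        simp [x₀, curvePoint]
        linarith

lemma card_image_offDiag {E : Type*} [DecidableEq E] (s : Finset E) :
    (s.offDiag.image fun x => s(x.1, x.2)).card = s.card.choose 2 :=
  Sym2.card_image_offDiag s

lemma exists_realizes_augmentedCyclic {k j : ℕ} (hj : 4 ≤ j) (hjk : j ≤ k) :
    ∃ V : Finset (Fin 4 → ℝ), Realizes V (k + 1) (k.choose 2 + j) ∧ HasSimplexFacet V := by
  have hj' : (4 : ℝ) ≤ j := by exact_mod_cast hj
  obtain ⟨κ, hold, hnot, hκ⟩ := ((eventually_exposed_curvePoint k (v := j + 1 / 4)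
    (by linarith)).and ((eventually_not_exposed_nearMidpoint hj hjk).and
    self_mem_nhdsWithin)).exists
  replace hκ : 0 < κ := hκ
  set p := nearMidpoint κ (j + 1 / 4) with hp
  set V := augmentedCyclic k p with hV
  let X : Finset (Fin 4 → ℝ) := (Finset.Icc 1 k).image fun i : ℕ => curvePoint i
  have hinj : Function.Injective fun i : ℕ => curvePoint i := fun a b h =>
    Nat.cast_injective (curvePoint_injective h)
  have hXcard : X.card = k := by
    rw [Finset.card_image_of_injective _ hinj, Nat.card_Icc, Nat.add_sub_cancel]
  have hpX : p ∉ X := fun h => by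
    obtain ⟨i, -, h⟩ := Finset.mem_image.1 h
    exact curvePoint_ne_nearMidpoint _ _ _ h
  have hmem : ∀ i : ℕ, 1 ≤ i → i ≤ k → curvePoint i ∈ V :=
    fun i => curvePoint_mem_augmentedCyclic
  have hpV : p ∈ V := Finset.mem_insert_self _ _
  have hadj : ∀ s t : ℕ, 1 ≤ s → s ≤ k → 1 ≤ t → t ≤ k → s < t →
      (exposedGraph V).Adj (curvePoint s) (curvePoint t) := fun s t hs hs' ht ht' hst =>
    ⟨fun h => hst.ne (hinj h), hmem s hs hs', hmem t ht ht',
      hold s (Finset.mem_Icc.2 ⟨hs, hs'⟩) t (Finset.mem_Icc.2 ⟨ht, ht'⟩) hst⟩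
  have hadjp : ∀ t : ℕ, 1 ≤ t → t ≤ j → (exposedGraph V).Adj p (curvePoint t) := fun t ht ht' =>
    ⟨(curvePoint_ne_nearMidpoint _ _ _).symm, hpV, hmem t ht (ht'.trans hjk),
      exposed_nearMidpoint hj hκ ht ht'⟩
  let N : Finset (Sym2 (Fin 4 → ℝ)) :=
    (Finset.Icc 1 j).image fun i : ℕ => s(p, curvePoint i)
  have hNcard : N.card = j := by
    rw [Finset.card_image_of_injective, Nat.card_Icc, Nat.add_sub_cancel]
    exact fun a b h => hinj (Sym2.congr_right.1 h)
  have hedges : (exposedGraph V).edgeSet = ((X.offDiag.image fun x => s(x.1, x.2)) ∪ N :) := by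
    have hp' : ∀ v, (exposedGraph V).Adj p v → s(p, v) ∈ N := by
      rintro v ⟨hne, -, hv, hex⟩
      obtain ⟨i, hi, hik, rfl⟩ := (eq_or_of_mem_augmentedCyclic hv).resolve_left hne.symm
      refine Finset.mem_image.2 ⟨i, Finset.mem_Icc.2 ⟨hi, ?_⟩, rfl⟩
      by_contra h
      exact hnot i (Finset.mem_Icc.2 ⟨not_le.1 h, hik⟩) hex
    ext z
    induction z with
    | h u v =>
      rw [Finset.mem_coe, Finset.mem_union]
      constructor
      · intro h
        by_cases hu : u = p
        · exact Or.inr (hu ▸ hp' v (hu ▸ h))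
        by_cases hv : v = p
        · rw [Sym2.eq_swap]
          exact Or.inr (hv ▸ hp' u (hv ▸ SimpleGraph.Adj.symm h))
        exact Or.inl (Finset.mem_image.2 ⟨(u, v), Finset.mem_offDiag.2
          ⟨Finset.mem_of_mem_insert_of_ne h.2.1 hu, Finset.mem_of_mem_insert_of_ne h.2.2.1 hv,
            h.1⟩, rfl⟩)
      · rintro (h | h)
        · obtain ⟨⟨a, b⟩, hab, h⟩ := Finset.mem_image.1 h
          rw [← h]
          obtain ⟨ha, hb, hne⟩ := Finset.mem_offDiag.1 hab
          obtain ⟨i, hi, rfl⟩ := Finset.mem_image.1 ha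
          obtain ⟨l, hl, rfl⟩ := Finset.mem_image.1 hb
          rw [Finset.mem_Icc] at hi hl
          rcases lt_trichotomy i l with hil | rfl | hil
          · exact hadj i l hi.1 hi.2 hl.1 hl.2 hil
          · exact absurd rfl hne
          · exact (hadj l i hl.1 hl.2 hi.1 hi.2 hil).symm
        · obtain ⟨i, hi, h⟩ := Finset.mem_image.1 h
          rw [← h]
          rw [Finset.mem_Icc] at hi
          exact hadjp i hi.1 hi.2
  refine ⟨V, ⟨?_, ?_, fun u hu => ?_, ?_⟩, hasSimplexFacet_augmentedCyclic hj hjk hκ⟩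
  · rw [hV, augmentedCyclic, Finset.card_insert_of_notMem hpX, hXcard]
  · rw [hedges, ncard_coe_finset, Finset.card_union_of_disjoint, card_image_offDiag, hXcard,
      hNcard]
    rw [Finset.disjoint_right]
    intro z hz hz'
    obtain ⟨i, -, rfl⟩ := Finset.mem_image.1 hz
    obtain ⟨⟨a, b⟩, hab, h⟩ := Finset.mem_image.1 hz'
    obtain ⟨ha, hb, -⟩ := Finset.mem_offDiag.1 hab
    rcases Sym2.eq_iff.1 h with ⟨h, -⟩ | ⟨-, h⟩
    · exact hpX (h ▸ ha)
    · exact hpX (h ▸ hb)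
  · rcases eq_or_of_mem_augmentedCyclic hu with rfl | ⟨i, hi, hik, rfl⟩
    · exact ⟨_, hadjp 1 le_rfl (by omega)⟩
    · by_cases h : i = 1
      · exact ⟨_, hadj i 2 hi hik (by omega) (by omega) (by omega)⟩
      · exact ⟨_, (hadj 1 i le_rfl (by omega) hi hik (by omega)).symm⟩
  · refine vectorSpan_eq_top_of_forall (Finset.mem_coe.2 (hmem 1 le_rfl (by omega)))
      fun a b c d h => ?_
    have h2 := h _ (Finset.mem_coe.2 (hmem 2 (by omega) (by omega)))
    have h3 := h _ (Finset.mem_coe.2 (hmem 3 (by omega) (by omega)))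
    have h4 := h _ (Finset.mem_coe.2 (hmem 4 (by omega) (by omega)))
    have h5 := h _ (Finset.mem_coe.2 hpV)
    simp only [hp, coeffForm_curvePoint, coeffForm_nearMidpoint] at h2 h3 h4 h5
    push_cast at h2 h3 h4 h5
    have ha : a = 0 := by linarith
    subst ha
    have h6 : b + c * ((5 / 2 + (j + 1 / 4)) / 2) + d * (5 / 2 * (j + 1 / 4)) = 0 := by
      have : κ * (b + c * ((5 / 2 + (j + 1 / 4)) / 2) + d * (5 / 2 * (j + 1 / 4))) = 0 := by
        linarith
      exact (mul_eq_zero.1 this).resolve_left hκ.ne'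
    have hc : c = -7 * d := by linarith
    have hb : b = 12 * d := by linarith
    subst hb hc
    have hd : d = 0 := by
      have : d * (12 - 7 * ((5 / 2 + (j + 1 / 4)) / 2) + 5 / 2 * (j + 1 / 4)) = 0 := by
        linear_combination h6
      refine (mul_eq_zero.1 this).resolve_right fun h => ?_
      linarith
    simp [hd]

lemma exists_realizes_simplex : ∃ V : Finset (Fin 4 → ℝ), Realizes V 5 10 ∧
    HasSimplexFacet V ∧ HasSimpleVertex V := by
  let b := Pi.basisFun ℝ (Fin 4)
  have hcb : ∀ i j, b.coord i (b j) = if i = j then 1 else 0 := b.coord_self_eq_ite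
  let V : Finset (Fin 4 → ℝ) := insert 0 (Finset.univ.image b)
  have h0V : 0 ∈ V := Finset.mem_insert_self _ _
  have hbV : ∀ i, b i ∈ V := fun i =>
    Finset.mem_insert_of_mem (Finset.mem_image_of_mem _ (Finset.mem_univ i))
  have hcases : ∀ u ∈ V, u = 0 ∨ ∃ i, u = b i := fun u hu => by
    rcases Finset.mem_insert.1 hu with h | h
    · exact Or.inl h
    · obtain ⟨i, -, rfl⟩ := Finset.mem_image.1 h
      exact Or.inr ⟨i, rfl⟩
  have hcard : V.card = 5 := by
    rw [Finset.card_insert_of_notMem, Finset.card_image_of_injective _ b.injective,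
      Finset.card_univ, Fintype.card_fin]
    intro h
    obtain ⟨i, -, h⟩ := Finset.mem_image.1 h
    exact b.ne_zero i h
  have h0 : ∀ i, (exposedGraph V).Adj 0 (b i) := fun i => by
    refine ⟨(b.ne_zero i).symm, h0V, hbV i, (∑ j, b.coord j) - b.coord i, ?_,
      fun u hu hu0 hui => ?_⟩
    · simp [hcb]
    · obtain ⟨j, rfl⟩ := (hcases u hu).resolve_left hu0
      have hij : i ≠ j := fun h => hui (by rw [h])
      simp [hcb, hij]
  have hb : ∀ i j, i ≠ j → (exposedGraph V).Adj (b i) (b j) := fun i j hij => by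
    refine ⟨b.injective.ne hij, hbV i, hbV j, -(b.coord i + b.coord j), ?_,
      fun u hu hui huj => ?_⟩
    · simp [hcb, hij, hij.symm]
    · rcases hcases u hu with rfl | ⟨l, rfl⟩
      · simp [hcb, hij.symm]
      · have hil : i ≠ l := fun h => hui (by rw [h])
        have hjl : j ≠ l := fun h => huj (by rw [h])
        simp [hcb, hij.symm, hil, hjl]
  have hadj : ∀ u ∈ V, ∀ v ∈ V, u ≠ v → (exposedGraph V).Adj u v := by
    intro u hu v hv huv
    rcases hcases u hu with rfl | ⟨i, rfl⟩ <;> rcases hcases v hv with rfl | ⟨l, rfl⟩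
    · exact absurd rfl huv
    · exact h0 l
    · exact (h0 i).symm
    · exact hb i l fun h => huv (by rw [h])
  have hedges : (exposedGraph V).edgeSet = (V.offDiag.image fun x => s(x.1, x.2) :) := by
    ext z
    induction z with
    | h u v =>
      rw [Finset.mem_coe]
      constructor
      · intro h
        exact Finset.mem_image.2 ⟨(u, v), Finset.mem_offDiag.2 ⟨h.2.1, h.2.2.1, h.1⟩, rfl⟩
      · intro h
        obtain ⟨⟨x, y⟩, hxy, h⟩ := Finset.mem_image.1 h
        rw [← h]
        obtain ⟨hx, hy, hne⟩ := Finset.mem_offDiag.1 hxy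
        exact hadj x hx y hy hne
  have hzero : ∀ i j, b.coord i (b j) = 0 → i ≠ j := fun i j h hij => by
    rw [hcb, if_pos hij] at h
    exact one_ne_zero h
  refine ⟨V, ⟨hcard, ?_, fun u hu => ?_, ?_⟩, ?_, ?_⟩
  · rw [hedges, ncard_coe_finset, card_image_offDiag, hcard]
    rfl
  · rcases hcases u hu with rfl | ⟨i, rfl⟩
    · exact ⟨_, h0 0⟩
    · exact ⟨_, (h0 i).symm⟩
  · rw [eq_top_iff, ← b.span_eq, Submodule.span_le]
    rintro _ ⟨i, rfl⟩
    have := vsub_mem_vectorSpan ℝ (Finset.mem_coe.2 (hbV i)) (Finset.mem_coe.2 h0V)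
    rwa [vsub_eq_sub, sub_zero] at this
  · refine ⟨0, b, 1, one_ne_zero, fun i => by rw [zero_add]; exact hbV i, fun u hu => ?_⟩
    rcases hcases u hu with rfl | ⟨i, rfl⟩
    · right; simp
    · exact Or.inl ⟨i, (zero_add _).symm⟩
  · refine ⟨0, h0V, b, fun i => by rw [zero_add]; exact hbV i, fun u hu i => ?_,
      fun u hu h2 h3 => ?_, fun i u hu h => ?_, ?_⟩
    · rw [sub_zero]
      rcases hcases u hu with rfl | ⟨l, rfl⟩
      · simp
      · rw [hcb]; split_ifs <;> simp
    · rw [sub_zero] at h2 h3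
      rcases hcases u hu with rfl | ⟨l, rfl⟩
      · exact Or.inl rfl
      · have h2 := hzero _ _ h2
        have h3 := hzero _ _ h3
        right
        rw [zero_add, zero_add]
        have hl : l = 0 ∨ l = 1 := by omega
        exact hl.imp (congrArg b) (congrArg b)
    · rcases hcases u hu with rfl | ⟨l, rfl⟩
      · exact Or.inl rfl
      · right
        have : l = i := by
          by_contra hne
          have h := h l hne
          rw [sub_zero] at h
          exact hzero l l h rfl
        rw [this, zero_add]
    · rw [zero_add, zero_add]
      exact (hb 0 1 (by decide)).2.2.2

end Families

section Assembly

/-- Some set with a simplex facet and a suitable simple vertex realizes `(m, e)`. -/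
def SimplePair (m e : ℕ) : Prop :=
  ∃ V : Finset (Fin 4 → ℝ), Realizes V m e ∧ HasSimplexFacet V ∧ HasSimpleVertex V

lemma SimplePair.truncate {m e m' e' : ℕ} (r : ℕ) (h : SimplePair m e) (hr : r ≤ 2)
    (hm : m' + r = m + 3) (he : e' + r + r.choose 2 = e + 6) : SimplePair m' e' := by
  obtain ⟨V, hV, -, hS⟩ := h
  obtain ⟨W, a, b, ha, hb, hW⟩ := hV.truncate hS hr
  obtain rfl : a = m' := by omega
  obtain rfl : b = e' := by omega
  exact ⟨W, hW⟩

lemma simplePair_six_thirteen : SimplePair 6 13 :=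
  SimplePair.truncate 2 exists_realizes_simplex le_rfl rfl rfl

lemma simplePair_seven_sixteen : SimplePair 7 16 :=
  simplePair_six_thirteen.truncate 2 le_rfl rfl rfl

lemma simplePair_eight_eighteen : SimplePair 8 18 :=
  simplePair_six_thirteen.truncate 1 one_le_two rfl rfl

lemma simplePair_of_two_mul_add_two (m : ℕ) : SimplePair (m + 7) (2 * m + 16) := by
  induction m using Nat.strong_induction_on with
  | h m ih =>
    match m with
    | 0 => exact simplePair_seven_sixteen
    | 1 => exact simplePair_eight_eighteen
    | 2 =>
      have h : SimplePair 7 15 := SimplePair.truncate 1 exists_realizes_simplex one_le_two rfl rfl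
      exact h.truncate 1 one_le_two rfl rfl
    | m + 3 =>
      exact (ih m (by omega)).truncate 0 (Nat.zero_le 2) (by omega)
        (by simp only [Nat.choose_zero_succ]; omega)

lemma simplePair_of_two_mul_add_three (m : ℕ) : SimplePair (m + 8) (2 * m + 19) := by
  induction m using Nat.strong_induction_on with
  | h m ih =>
    match m with
    | 0 => exact simplePair_seven_sixteen.truncate 2 le_rfl rfl rfl
    | 1 => exact simplePair_seven_sixteen.truncate 1 one_le_two rfl rfl
    | 2 => exact simplePair_eight_eighteen.truncate 1 one_le_two rfl rfl
    | m + 3 =>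
      exact (ih m (by omega)).truncate 0 (Nat.zero_le 2) (by omega)
        (by simp only [Nat.choose_zero_succ]; omega)

lemma exists_realizes {m e : ℕ} (hm : 6 ≤ m) (h : 2 * m + 2 ≤ e) (he : e ≤ m.choose 2) :
    ∃ V : Finset (Fin 4 → ℝ), Realizes V m e ∧ HasSimplexFacet V := by
  induction m, hm using Nat.le_induction generalizing e with
  | base =>
    have hc : Nat.choose 6 2 = 15 := rfl
    obtain ⟨j, rfl⟩ : ∃ j, e = Nat.choose 5 2 + j := Nat.exists_eq_add_of_le (by
      have : Nat.choose 5 2 = 10 := rfl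
      omega)
    have : Nat.choose 5 2 = 10 := rfl
    exact exists_realizes_augmentedCyclic (by omega) (by omega)
  | succ m hm ih =>
    have hc : (m + 1).choose 2 = m + m.choose 2 := by
      rw [Nat.choose_succ_succ' m 1, Nat.choose_one_right]
    by_cases hcyc : m.choose 2 + 4 ≤ e
    · obtain ⟨j, rfl⟩ : ∃ j, e = m.choose 2 + j := Nat.exists_eq_add_of_le (by omega)
      exact exists_realizes_augmentedCyclic (by omega) (by omega)
    by_cases hst : 2 * m + 6 ≤ e
    · obtain ⟨e, rfl⟩ := Nat.exists_eq_add_of_le' (show 4 ≤ e by omega)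
      obtain ⟨V, hV, hF⟩ := ih (e := e) (by omega) (by omega)
      exact hV.stack hF
    obtain rfl | rfl : e = 2 * m + 4 ∨ e = 2 * m + 5 := by omega
    · obtain ⟨m, rfl⟩ := Nat.exists_eq_add_of_le' hm
      obtain ⟨V, hV, hF, -⟩ := simplePair_of_two_mul_add_two m
      exact ⟨V, hV, hF⟩
    · obtain rfl | hm' := hm.eq_or_lt
      · obtain ⟨V, hV, hF, -⟩ := simplePair_six_thirteen
        exact hV.stack hF
      · obtain ⟨m, rfl⟩ := Nat.exists_eq_add_of_le' (show 7 ≤ m from hm')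
        obtain ⟨V, hV, hF, -⟩ := simplePair_of_two_mul_add_three m
        exact ⟨V, hV, hF⟩

end Assembly

/-- The `(f₀, f₁)` pairs of 4-polytopes with excess degree `> 2` are exactly those
with `2·f₀ + 1 < f₁ ≤ f₀·(f₀-1)/2`. -/
theorem stmt13 :
    {v : ℕ × ℕ | ∃ (n : ℕ) (P : Set (Fin n → ℝ)), IsDPolytope 4 P ∧
        f₀ P = v.1 ∧ f₁ P = v.2 ∧ 2 < 2 * (f₁ P : ℤ) - 4 * (f₀ P : ℤ)} =
      {v : ℕ × ℕ | 2 * v.1 + 1 < v.2 ∧ 2 * v.2 ≤ v.1 * (v.1 - 1)} := by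
  ext ⟨m, e⟩
  constructor
  · rintro ⟨n, P, hP, rfl, rfl, h⟩
    refine ⟨by dsimp only; omega, ?_⟩
    have := hP.1.f₁_le_choose
    rw [Nat.choose_two_right, Nat.le_div_iff_mul_le two_pos] at this
    rwa [mul_comm 2]
  · rintro ⟨h, h'⟩
    dsimp only at h h'
    have he : e ≤ m.choose 2 := by
      rw [Nat.choose_two_right, Nat.le_div_iff_mul_le two_pos]
      linarith
    have hm : 6 ≤ m := by
      by_contra hm
      have hm : m < 6 := not_le.1 hm
      interval_cases m <;> omega
    obtain ⟨V, hV, -⟩ := exists_realizes hm h he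
    have h0 := (f₀_convexHull hV.exists_adj).trans hV.card_eq
    have h1 := (f₁_convexHull hV.exists_adj).trans hV.ncard_edgeSet
    refine ⟨4, convexHull ℝ V, isDPolytope_convexHull hV.vectorSpan_eq, h0, h1, ?_⟩
    rw [h0, h1]
    omega
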